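/- arXiv:math/0703466 — 3 statements merged into one kernel-verified Lean document; each statement's English description precedes it below -/
import Mathlib

section
/- Let f : ℝ² → ℝ² be an orientation-preserving topological embedding. If f has a periodic point (a point p with f^n(p) = p for some integer n ≥ 1), then the set Fix(f) of fixed points of f is nonempty. -/
open Topology Filter Metric Set Function

noncomputable section

/-- The plane with the Euclidean norm. -/
abbrev Plane : Type := EuclideanSpace ℝ (Fin 2)

/-- An orientation-preserving topological embedding of the plane: a topological embedding
which is isotopic to the identity through topological embeddings. -/
def IsOrientationPreservingEmbedding (f : Plane → Plane) : Prop :=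
  Topology.IsEmbedding f ∧
  ∃ F : ℝ → Plane → Plane,
    Continuous (fun q : ℝ × Plane => F q.1 q.2) ∧
    (∀ t : ℝ, Topology.IsEmbedding (F t)) ∧ F 0 = id ∧ F 1 = f

def PIso (f : ℂ → ℂ) : Prop :=
  ∃ F : ℝ → ℂ → ℂ, Continuous (fun q : ℝ × ℂ => F q.1 q.2) ∧
    (∀ t : ℝ, Injective (F t)) ∧ F 0 = id ∧ F 1 = f

def PGood (f : ℂ → ℂ) : Prop := PIso f ∧ ∀ x, f x ≠ x

lemma PIso.cont {f : ℂ → ℂ} (h : PIso f) : Continuous f := by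
  obtain ⟨F, hc, -, -, rfl⟩ := h
  exact hc.comp (by fun_prop : Continuous fun x : ℂ => ((1 : ℝ), x))

lemma PIso.inj {f : ℂ → ℂ} (h : PIso f) : Injective f := by
  obtain ⟨F, -, hi, -, rfl⟩ := h
  exact hi 1

lemma PIso.comp {g f : ℂ → ℂ} (hg : PIso g) (hf : PIso f) : PIso (g ∘ f) := by
  obtain ⟨F, hc, hi, h0, rfl⟩ := hf
  obtain ⟨G, hc', hi', h0', rfl⟩ := hg
  refine ⟨fun t => G t ∘ F t, ?_, fun t => (hi' t).comp (hi t), by simp [h0, h0'], rfl⟩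
  exact hc'.comp (continuous_fst.prodMk hc)

/-- period two -/
lemma no_period_two {f : ℂ → ℂ} (hf : PGood f) (p : ℂ) : f (f p) ≠ p := by
  intro hp
  obtain ⟨hI, hfix⟩ := hf
  have hfc := hI.cont
  obtain ⟨F, hc, hi, h0, h1⟩ := hI
  set q := f p with hq
  have hpq : p ≠ q := fun h => hfix p h.symm
  let W : C(ℝ × ℂ, ℂ) := ⟨fun z => F z.1 (f z.2) - F z.1 z.2,
    (hc.comp (continuous_fst.prodMk (hfc.comp continuous_snd))).sub hc⟩
  have hW : ∀ a, W a ∈ ({0}ᶜ : Set ℂ) := by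
    intro a
    simp only [mem_compl_iff, mem_singleton_iff]
    intro h
    exact hfix a.2 (hi a.1 (sub_eq_zero.1 h))
  obtain ⟨L, ⟨-, hL⟩, -⟩ := Complex.isCoveringMapOn_exp.existsUnique_continuousMap_lifts W
    (a₀ := (0, 0)) (e₀ := Complex.log (W (0, 0))) (Complex.exp_log (hW _)) hW
  have hL' : ∀ t x, Complex.exp (L (t, x)) = F t (f x) - F t x := fun t x => congrFun hL (t, x)
  have e1 : L (1, p) - L (0, q) = L (1, q) - L (0, p) := by
    have := Complex.isCoveringMap_exp.const_of_comp (A := ℂ)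
      (g := fun x => L (1, x) - L (0, f x)) (by fun_prop) (by
        intro a a'
        have : ∀ a, Complex.exp (L (1, a) - L (0, f a)) = 1 := by
          intro a
          rw [Complex.exp_sub, hL', hL', h0, h1]
          exact div_self (sub_ne_zero.2 (hfix _))
        simp [this])
    have := this p q
    simpa [← hq, hp] using this
  have e2 : L (1, q) - L (1, p) = L (0, q) - L (0, p) := by
    have := Complex.isCoveringMap_exp.const_of_comp (A := ℝ)
      (g := fun t => L (t, q) - L (t, p)) (by fun_prop) (by
        intro a a'
        have : ∀ t, Complex.exp (L (t, q) - L (t, p)) = -1 := by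
          intro t
          rw [Complex.exp_sub, hL', hL', hp, ← hq]
          have : F t q - F t p ≠ 0 := sub_ne_zero.2 fun h => hpq (hi t h).symm
          rw [div_eq_iff this]; ring
        simp [this])
    exact this 1 0
  have e3 : L (0, q) = L (0, p) := by linear_combination (e1 + e2) / (-2)
  have := congrArg Complex.exp e3
  rw [hL', hL', h0, hp, ← hq] at this
  simp only [id] at this
  exact hpq (by linear_combination this / 2)

/-- local push -/
lemma push_local (a b : ℂ) (ρ : ℝ) (h : dist b a < ρ) :
    ∃ g, PIso g ∧ (∀ x, x ∉ ball a ρ → g x = x) ∧ g a = b := by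
  have hρ : 0 < ρ := dist_nonneg.trans_lt h
  let ψ : ℂ → ℝ := fun x => max 0 (1 - dist x a / ρ)
  have hψL : ∀ x y, |ψ x - ψ y| ≤ dist x y / ρ := by
    intro x y
    refine (abs_max_sub_max_le_max _ _ _ _).trans ?_
    rw [sub_self, abs_zero, max_eq_right (abs_nonneg _)]
    have : (1 - dist x a / ρ) - (1 - dist y a / ρ) = (dist y a - dist x a) / ρ := by ring
    rw [this, abs_div, abs_of_pos hρ]
    gcongr
    rw [dist_comm x y]; exact abs_dist_sub_le _ _ _
  let τ : ℝ → ℝ := fun t => max 0 (min 1 t)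
  have hτ0 : ∀ t, 0 ≤ τ t := fun t => le_max_left _ _
  have hτ1 : ∀ t, τ t ≤ 1 := fun t => max_le zero_le_one (min_le_left _ _)
  have key : ∀ t : ℝ, Injective fun x : ℂ => x + ((τ t * ψ x : ℝ) : ℂ) * (b - a) := by
    intro t x y hxy
    by_contra hne
    simp only at hxy
    have h1 : x - y = ((τ t * (ψ y - ψ x) : ℝ) : ℂ) * (b - a) := by
      push_cast at hxy ⊢; linear_combination hxy
    have h2 : dist x y = τ t * |ψ y - ψ x| * dist b a := by
      rw [dist_eq_norm, h1, norm_mul, Complex.norm_real, Real.norm_eq_abs, abs_mul,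
        abs_of_nonneg (hτ0 t), dist_eq_norm b a]
    have hd : 0 < dist x y := dist_pos.2 hne
    have h3 : τ t * |ψ y - ψ x| * dist b a ≤ 1 * (dist x y / ρ) * dist b a := by
      have := hψL y x
      rw [dist_comm] at this
      have := hτ0 t
      have := hτ1 t
      gcongr
    have h4 : 1 * (dist x y / ρ) * dist b a < dist x y := by
      rw [one_mul, div_mul_eq_mul_div, div_lt_iff₀ hρ]
      exact mul_lt_mul_of_pos_left h hd
    linarith
  refine ⟨_, ⟨fun t x => x + ((τ t * ψ x : ℝ) : ℂ) * (b - a), ?_, key, ?_, rfl⟩, ?_, ?_⟩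
  · simp only [τ, ψ]; fun_prop
  · funext x; simp [τ]
  · intro x hx
    have : ψ x = 0 := by
      simp only [mem_ball, not_lt] at hx
      apply max_eq_left
      have := (one_le_div hρ).2 hx
      linarith
    simp [this]
  · simp [τ, ψ]

lemma push {K U : Set ℂ} (hK : IsPreconnected K) (hU : IsOpen U) (hKU : K ⊆ U) {a b : ℂ}
    (ha : a ∈ K) (hb : b ∈ K) :
    ∃ g, PIso g ∧ (∀ x, x ∉ U → g x = x) ∧ g a = b := by
  let R : Set ℂ := {b | ∃ g, PIso g ∧ (∀ x, x ∉ U → g x = x) ∧ g a = b}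
  have step : ∀ c d ρ, ball c ρ ⊆ U → dist d c < ρ → c ∈ R → d ∈ R := by
    rintro c d ρ hs hd ⟨g, hg, hgU, hga⟩
    obtain ⟨g', hg', hgU', hga'⟩ := push_local c d ρ hd
    refine ⟨g' ∘ g, hg'.comp hg, fun x hx => ?_, by simp [hga, hga']⟩
    simp only [comp_apply, hgU x hx]
    exact hgU' x fun h => hx (hs h)
  have hball : ∀ c ∈ U, ∃ ρ > 0, ∀ d ∈ ball c ρ, (c ∈ R ↔ d ∈ R) := by
    intro c hc
    obtain ⟨ρ, hρ, hs⟩ := Metric.isOpen_iff.1 hU c hc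
    refine ⟨ρ / 2, by positivity, fun d hd => ?_⟩
    rw [mem_ball] at hd
    constructor
    · exact step c d ρ hs (by linarith)
    · refine step d c (ρ / 2) (fun z hz => hs ?_) (by rwa [dist_comm])
      rw [mem_ball] at hz ⊢
      linarith [dist_triangle z d c]
  have haR : a ∈ R := by
    refine ⟨id, ⟨fun _ => id, by fun_prop, fun _ => injective_id, rfl, rfl⟩, fun _ _ => rfl, rfl⟩
  by_contra hbR
  have o1 : IsOpen (U ∩ R) := by
    rw [Metric.isOpen_iff]
    rintro c ⟨hc, hcR⟩
    obtain ⟨ρ, hρ, h⟩ := hball c hc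
    obtain ⟨ρ', hρ', h'⟩ := Metric.isOpen_iff.1 hU c hc
    exact ⟨min ρ ρ', lt_min hρ hρ', fun d hd => ⟨h' (ball_subset_ball (min_le_right _ _) hd),
      (h d (ball_subset_ball (min_le_left _ _) hd)).1 hcR⟩⟩
  have o2 : IsOpen (U ∩ Rᶜ) := by
    rw [Metric.isOpen_iff]
    rintro c ⟨hc, hcR⟩
    obtain ⟨ρ, hρ, h⟩ := hball c hc
    obtain ⟨ρ', hρ', h'⟩ := Metric.isOpen_iff.1 hU c hc
    exact ⟨min ρ ρ', lt_min hρ hρ', fun d hd => ⟨h' (ball_subset_ball (min_le_right _ _) hd),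
      fun hd' => hcR ((h d (ball_subset_ball (min_le_left _ _) hd)).2 hd')⟩⟩
  obtain ⟨z, -, hz1, hz2⟩ := hK _ _ o1 o2 (fun z hz => by
    by_cases h : z ∈ R
    · exact Or.inl ⟨hKU hz, h⟩
    · exact Or.inr ⟨hKU hz, h⟩) ⟨a, ha, hKU ha, haR⟩ ⟨b, hb, hKU hb, hbR⟩
  exact hz2.2 hz1.2

lemma good_push {f g : ℂ → ℂ} {U : Set ℂ} (hf : PGood f) (hg : PIso g)
    (hgU : ∀ x, x ∉ U → g x = x) (hU : ∀ x ∈ U, f x ∉ U) : PGood (g ∘ f) := by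
  refine ⟨hg.comp hf.1, fun x hx => ?_⟩
  simp only [comp_apply] at hx
  by_cases h : f x ∈ U
  · by_cases hxU : x ∈ U
    · exact hU x hxU h
    · have := hg.inj (hx.trans (hgU x hxU).symm)
      exact hf.2 x this
  · rw [hgU _ h] at hx
    exact hf.2 x hx

lemma exists_free_nhd {f : ℂ → ℂ} (hf : Continuous f) {K : Set ℂ} (hK : IsCompact K)
    (hfree : ∀ x ∈ K, f x ∉ K) : ∃ U, IsOpen U ∧ K ⊆ U ∧ ∀ x ∈ U, f x ∉ U := by
  have hd : Disjoint K (f '' K) := by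
    rw [Set.disjoint_left]
    rintro _ h ⟨x, hx, rfl⟩
    exact hfree x hx h
  obtain ⟨V₁, V₂, o1, o2, h1, h2, h12⟩ := SeparatedNhds.of_isCompact_isCompact hK (hK.image hf) hd
  refine ⟨V₁ ∩ f ⁻¹' V₂, o1.inter (o2.preimage hf), fun x hx => ⟨h1 hx, h2 ⟨x, hx, rfl⟩⟩, ?_⟩
  rintro x ⟨-, hx⟩ ⟨hx', -⟩
  exact Set.disjoint_left.1 h12 hx' hx

/-- iterates agree -/
lemma iter_agree {f g : ℂ → ℂ} {U : Set ℂ} (hgU : ∀ x, x ∉ U → g x = x) (y : ℂ) (m : ℕ)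
    (h : ∀ i, 1 ≤ i → i < m → f^[i] y ∉ U) : ∀ i < m, (g ∘ f)^[i] y = f^[i] y := by
  intro i
  induction i with
  | zero => intro _; rfl
  | succ i ih =>
    intro hi
    rw [iterate_succ_apply', ih (by omega), comp_apply, ← iterate_succ_apply' f]
    exact hgU _ (h _ (by omega) hi)

lemma closing {n : ℕ} (IH : ∀ m, 1 ≤ m → m < n → ∀ f, PGood f → ∀ p, f^[m] p ≠ p)
    {f : ℂ → ℂ} (hf : PGood f) {K : Set ℂ} (hK : IsCompact K) (hKc : IsPreconnected K)
    (hfree : ∀ x ∈ K, f x ∉ K) {y : ℂ} (hy : y ∈ K) {m : ℕ} (hm : 1 ≤ m) (hmn : m < n) :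
    f^[m] y ∉ K := by
  induction m using Nat.strong_induction_on with
  | _ m ih =>
    intro hmK
    obtain ⟨U, hUo, hKU, hU⟩ := exists_free_nhd hf.1.cont hK hfree
    let S : Set ℂ := (fun i => f^[i] y) '' (Finset.Ico 1 m : Set ℕ)
    have hS : S.Finite := (Finset.finite_toSet _).image _
    have hKS : K ⊆ U ∩ Sᶜ := by
      refine fun z hz => ⟨hKU hz, ?_⟩
      rintro ⟨i, hi, rfl⟩
      simp at hi
      exact ih i hi.2 hi.1 (by omega) hz
    obtain ⟨g, hg, hgU, hgy⟩ := push hKc (hUo.inter hS.isClosed.isOpen_compl) hKS hmK hy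
    have hgood := good_push hf hg hgU (fun x hx h => hU x hx.1 h.1)
    refine IH m hm hmn _ hgood y ?_
    have := iter_agree (f := f) hgU y m (by
      rintro i hi hi' ⟨-, h⟩
      exact h ⟨i, by simp [hi, hi'], rfl⟩) (m - 1) (by omega)
    obtain ⟨k, rfl⟩ : ∃ k, m = k + 1 := ⟨m - 1, by omega⟩
    rw [Nat.add_sub_cancel] at this
    rw [iterate_succ_apply', this, comp_apply, ← iterate_succ_apply' f, hgy]

lemma exists_touch {f : ℂ → ℂ} (hf : Continuous f) (p : ℂ) :
    ∃ x, ‖x - p‖ ≤ ‖f x - p‖ ∧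
      (∀ a, ‖a - p‖ ≤ ‖f x - p‖ → ‖f a - p‖ ≤ ‖f x - p‖ → ‖f a - p‖ = ‖f x - p‖) ∧
      (‖x - p‖ < ‖f x - p‖ ∨
        ∀ a, ‖a - p‖ ≤ ‖f x - p‖ → ‖f a - p‖ ≤ ‖f x - p‖ → ‖a - p‖ = ‖f x - p‖) := by
  let m : ℂ → ℝ := fun a => max ‖a - p‖ ‖f a - p‖
  have hm : Continuous m := by fun_prop
  obtain ⟨x₀, -, hx₀⟩ := (isCompact_closedBall p ‖f p - p‖).exists_isMinOn
    ⟨p, by simp⟩ hm.continuousOn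
  have hmin : ∀ a, m x₀ ≤ m a := by
    intro a
    by_cases ha : a ∈ closedBall p ‖f p - p‖
    · exact hx₀ ha
    · have h1 : m x₀ ≤ m p := hx₀ (by simp)
      have h2 : m p = ‖f p - p‖ := by simp [m]
      rw [mem_closedBall, not_le, dist_eq_norm] at ha
      have : ‖a - p‖ ≤ m a := le_max_left _ _
      linarith
  set r := m x₀ with hr
  have H : ∀ a, ‖a - p‖ ≤ r → ‖f a - p‖ ≤ r → ‖f a - p‖ = r := by
    intro a h1 h2
    by_contra hne
    have hlt : ‖f a - p‖ < r := lt_of_le_of_ne h2 hne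
    have hr0 : 0 < r := (norm_nonneg _).trans_lt hlt
    have hc : Continuous fun t : ℝ => ‖f (p + (1 - t : ℝ) * (a - p)) - p‖ := by fun_prop
    have hev : ∀ᶠ t in 𝓝[>] (0 : ℝ), ‖f (p + (1 - t : ℝ) * (a - p)) - p‖ < r := by
      apply (hc.tendsto 0).mono_left nhdsWithin_le_nhds |>.eventually_lt_const
      simpa using hlt
    have hev2 : ∀ᶠ t in 𝓝[>] (0 : ℝ), t ∈ Ioo (0 : ℝ) 1 := Ioo_mem_nhdsGT one_pos
    obtain ⟨t, ht, ht0, ht1⟩ := (hev.and hev2).exists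
    have := hmin (p + (1 - t : ℝ) * (a - p))
    refine absurd this (not_le.2 (max_lt ?_ ht))
    rw [add_sub_cancel_left, norm_mul, Complex.norm_real, Real.norm_eq_abs, abs_of_pos (by linarith)]
    nlinarith [norm_nonneg (a - p)]
  have hx₀1 : ‖x₀ - p‖ ≤ r := le_max_left _ _
  have hx₀2 : ‖f x₀ - p‖ ≤ r := le_max_right _ _
  by_cases hcase : ∃ x, ‖x - p‖ < r ∧ ‖f x - p‖ ≤ r
  · obtain ⟨x, h1, h2⟩ := hcase
    have h3 := H x h1.le h2
    refine ⟨x, ?_, ?_, Or.inl ?_⟩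
    · rw [h3]; exact h1.le
    · rwa [h3]
    · rwa [h3]
  · push Not at hcase
    have h3 := H x₀ hx₀1 hx₀2
    refine ⟨x₀, ?_, ?_, Or.inr ?_⟩
    · rwa [h3]
    · rwa [h3]
    · rw [h3]
      intro a h1 h2
      by_contra hne
      exact absurd h2 (not_le.2 (hcase a (lt_of_le_of_ne h1 hne)))

lemma seg_norm {p x z : ℂ} (hz : z ∈ segment ℝ p x) :
    ‖z - p‖ ≤ ‖x - p‖ ∧ (‖z - p‖ = ‖x - p‖ → z = x) := by
  rw [segment_eq_image_lineMap] at hz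
  obtain ⟨t, ⟨h0, h1⟩, rfl⟩ := hz
  have e : (AffineMap.lineMap p x t : ℂ) - p = (t : ℂ) * (x - p) := by
    simp [AffineMap.lineMap_apply]
  have e2 : ‖(AffineMap.lineMap p x t : ℂ) - p‖ = t * ‖x - p‖ := by
    rw [e, norm_mul, Complex.norm_real, Real.norm_eq_abs, abs_of_nonneg h0]
  rw [e2]
  refine ⟨by nlinarith [norm_nonneg (x - p)], fun h => ?_⟩
  rcases eq_or_ne (x - p) 0 with hx | hx
  · rw [hx, mul_zero, sub_eq_zero] at e
    rw [e, sub_eq_zero.1 hx]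
  · have : 0 < ‖x - p‖ := norm_pos_iff.2 hx
    have : t = 1 := by
      have : (t - 1) * ‖x - p‖ = 0 := by linarith
      rcases mul_eq_zero.1 this with h | h
      · linarith
      · linarith
    subst this
    simp

lemma geo {p x y : ℂ} (hxy : x ≠ y) (hx : ‖x - p‖ ≤ ‖y - p‖) :
    ∃ c, c ≠ p ∧ p ∉ segment ℝ c y ∧
      (∀ z ∈ segment ℝ p c ∪ segment ℝ c y,
        ‖z - p‖ ≤ ‖y - p‖ ∧ (‖z - p‖ = ‖y - p‖ → z = y)) ∧
      (∀ z ∈ segment ℝ p x, z ∈ segment ℝ p c ∪ segment ℝ c y → z = p) := by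
  set d := y - p with hd
  have hd0 : d ≠ 0 := by
    intro h
    rw [h, norm_zero] at hx
    have h1 : x - p = 0 := norm_le_zero_iff.1 hx
    exact hxy (by linear_combination h1 - h)
  have hdn : 0 < ‖d‖ := norm_pos_iff.2 hd0
  set w := (x - p) / d with hw
  have hxw : x - p = d * w := by rw [hw]; field_simp
  have hw1 : w ≠ 1 := by
    intro h; rw [h] at hxw; exact hxy (by rw [hd] at hxw; linear_combination hxw)
  have hwn : ‖w‖ ≤ 1 := by
    rw [hw, norm_div]; exact (div_le_one hdn).2 hx
  obtain ⟨σ, hσ, hσw⟩ : ∃ σ : ℝ, (σ = 1 ∨ σ = -1) ∧ σ * w.im ≤ 0 := by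
    rcases le_total w.im 0 with h | h
    · exact ⟨1, Or.inl rfl, by linarith⟩
    · exact ⟨-1, Or.inr rfl, by linarith⟩
  have hσ0 : σ ≠ 0 := by rcases hσ with h | h <;> rw [h] <;> norm_num
  have hσ2 : σ * σ = 1 := by rcases hσ with h | h <;> rw [h] <;> norm_num
  let c : ℂ := p + d * ⟨0, σ / 2⟩
  -- normal form for points of B
  have hB1 : ∀ z ∈ segment ℝ p c, ∃ t : ℝ, 0 ≤ t ∧ t ≤ 1 ∧ z = p + d * ⟨0, t * σ / 2⟩ := by
    intro z hz
    rw [segment_eq_image_lineMap] at hz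
    obtain ⟨t, ⟨h0, h1⟩, rfl⟩ := hz
    refine ⟨t, h0, h1, ?_⟩
    have : (⟨0, t * σ / 2⟩ : ℂ) = (t : ℂ) * ⟨0, σ / 2⟩ := by
      apply Complex.ext <;> simp; ring
    rw [this]
    simp [AffineMap.lineMap_apply, c]; ring
  have hB2 : ∀ z ∈ segment ℝ c y, ∃ t : ℝ, 0 ≤ t ∧ t ≤ 1 ∧ z = p + d * ⟨t, (1 - t) * σ / 2⟩ := by
    intro z hz
    rw [segment_eq_image_lineMap] at hz
    obtain ⟨t, ⟨h0, h1⟩, rfl⟩ := hz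
    refine ⟨t, h0, h1, ?_⟩
    have : (⟨t, (1 - t) * σ / 2⟩ : ℂ) = (t : ℂ) + (1 - t) * ⟨0, σ / 2⟩ := by
      apply Complex.ext <;> simp; ring
    rw [this]
    simp [AffineMap.lineMap_apply, c]
    rw [hd]; ring
  have hA : ∀ z ∈ segment ℝ p x, ∃ t : ℝ, 0 ≤ t ∧ t ≤ 1 ∧ z = p + d * (t * w) := by
    intro z hz
    rw [segment_eq_image_lineMap] at hz
    obtain ⟨t, ⟨h0, h1⟩, rfl⟩ := hz
    refine ⟨t, h0, h1, ?_⟩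
    simp [AffineMap.lineMap_apply]
    rw [hxw]; ring
  have hnorm : ∀ (β : ℂ), β.re ^ 2 + β.im ^ 2 ≤ 1 → (β.re ^ 2 + β.im ^ 2 = 1 → β = 1) →
      ∀ z, z = p + d * β → ‖z - p‖ ≤ ‖d‖ ∧ (‖z - p‖ = ‖d‖ → z = y) := by
    rintro β hβ hβ' z rfl
    have hn : ‖β‖ ^ 2 = β.re ^ 2 + β.im ^ 2 := by
      rw [← Complex.normSq_eq_norm_sq, Complex.normSq_apply]; ring
    rw [add_sub_cancel_left, norm_mul]
    have : ‖β‖ ≤ 1 := by nlinarith [norm_nonneg β]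
    refine ⟨by nlinarith, fun h => ?_⟩
    have h1 : ‖β‖ = 1 := by
      have : ‖d‖ * (‖β‖ - 1) = 0 := by linarith
      rcases mul_eq_zero.1 this with h | h <;> linarith
    rw [hβ' (by rw [← hn, h1]; norm_num), hd]; ring
  refine ⟨c, ?_, ?_, ?_, ?_⟩
  · intro h
    have : d * ⟨0, σ / 2⟩ = 0 := by linear_combination h
    rcases mul_eq_zero.1 this with h | h
    · exact hd0 h
    · have := congrArg Complex.im h
      simp at this
      exact hσ0 this
  · intro h
    obtain ⟨t, h0, h1, e⟩ := hB2 p h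
    have : d * ⟨t, (1 - t) * σ / 2⟩ = 0 := by linear_combination -e
    rcases mul_eq_zero.1 this with h | h
    · exact hd0 h
    · have h2 := congrArg Complex.im h
      have h3 := congrArg Complex.re h
      simp at h2 h3
      rcases h2 with h2 | h2
      · linarith
      · exact hσ0 h2
  · rintro z (hz | hz)
    · obtain ⟨t, h0, h1, e⟩ := hB1 z hz
      have : (t * σ / 2) ^ 2 = t ^ 2 / 4 := by linear_combination t ^ 2 / 4 * hσ2
      refine hnorm _ ?_ ?_ z e
      · simp only; rw [this]; nlinarith
      · simp only; rw [this]; intro h; nlinarith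
    · obtain ⟨t, h0, h1, e⟩ := hB2 z hz
      have : ((1 - t) * σ / 2) ^ 2 = (1 - t) ^ 2 / 4 := by linear_combination (1 - t) ^ 2 / 4 * hσ2
      refine hnorm _ ?_ ?_ z e
      · simp only; rw [this]; nlinarith
      · simp only; rw [this]; intro h
        have : t = 1 := by nlinarith
        subst this
        apply Complex.ext <;> simp
  · intro z hz hz'
    obtain ⟨s, s0, s1, e⟩ := hA z hz
    rcases hz' with hz' | hz'
    · obtain ⟨t, h0, h1, e'⟩ := hB1 z hz'
      have : (s : ℂ) * w = ⟨0, t * σ / 2⟩ := mul_left_cancel₀ hd0 (by linear_combination e' - e)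
      have h2 := congrArg Complex.im this
      simp at h2
      have ht : t = 0 := by
        have : t = 2 * s * (σ * w.im) := by linear_combination -t * hσ2 - 2 * σ * h2
        nlinarith
      subst ht
      rw [e']; 
      have : (⟨0, 0 * σ / 2⟩ : ℂ) = 0 := by apply Complex.ext <;> simp
      rw [this]; ring
    · obtain ⟨t, h0, h1, e'⟩ := hB2 z hz'
      have : (s : ℂ) * w = ⟨t, (1 - t) * σ / 2⟩ :=
        mul_left_cancel₀ hd0 (by linear_combination e' - e)
      have h2 := congrArg Complex.im this
      simp at h2
      have ht : t = 1 := by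
        have : 1 - t = 2 * s * (σ * w.im) := by
          linear_combination -(1 - t) * hσ2 - 2 * σ * h2
        nlinarith
      subst ht
      have h5 : (s : ℂ) * w = 1 := by
        rw [this]; apply Complex.ext <;> simp
      exfalso
      have h6 : s * ‖w‖ = 1 := by
        have := congrArg norm h5
        rwa [norm_mul, Complex.norm_real, Real.norm_eq_abs, abs_of_nonneg s0, norm_one] at this
      have : s = 1 := by nlinarith [norm_nonneg w]
      subst this
      exact hw1 (by simpa using h5)

lemma isCompact_segment' (a b : ℂ) : IsCompact (segment ℝ a b) := by
  rw [segment_eq_image_lineMap]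
  exact isCompact_Icc.image (by fun_prop)

lemma main_step {n : ℕ} (hn : 3 ≤ n)
    (IH : ∀ m, 1 ≤ m → m < n → ∀ f, PGood f → ∀ p, f^[m] p ≠ p)
    {f : ℂ → ℂ} (hf : PGood f) (p : ℂ) : f^[n] p ≠ p := by
  intro hper
  have hc := hf.1.cont
  have hinj := hf.1.inj
  obtain ⟨x, hxr, hM, hcase⟩ := exists_touch hc p
  obtain ⟨c, hcp, hpc, hBn, hAB⟩ := geo (hf.2 x).symm hxr
  set r := ‖f x - p‖ with hr
  set A := segment ℝ p x with hA
  set B := segment ℝ p c ∪ segment ℝ c (f x) with hB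
  have hAn : ∀ z ∈ A, ‖z - p‖ ≤ r ∧ (‖z - p‖ = r → z = x) := by
    intro z hz
    have := seg_norm hz
    refine ⟨this.1.trans hxr, fun h => this.2 (le_antisymm this.1 (by linarith))⟩
  have hr0 : 0 < r := by
    rcases (norm_nonneg (f x - p)).eq_or_lt with h | h
    · exfalso
      rw [← hr] at h
      have h1 : x - p = 0 := norm_le_zero_iff.1 (by linarith)
      have h2 : f x - p = 0 := norm_le_zero_iff.1 (by linarith)
      exact hf.2 x (by linear_combination h2 - h1)
    · exact h
  have hpA : p ∈ A := left_mem_segment _ _ _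
  have hxA : x ∈ A := right_mem_segment _ _ _
  have hpB : p ∈ B := Or.inl (left_mem_segment _ _ _)
  have hyB : f x ∈ B := Or.inr (right_mem_segment _ _ _)
  -- fact 1
  have F1 : ∀ a ∈ A, f a ∉ A := by
    intro a ha hfa
    have h1 := hM a (hAn a ha).1 (hAn _ hfa).1
    rcases hcase with h | h
    · have := (seg_norm hfa).1
      linarith
    · have h2 := h a (hAn a ha).1 (hAn _ hfa).1
      have e1 := (hAn a ha).2 h2
      have e2 := (hAn _ hfa).2 h1
      exact hf.2 a (by rw [e2, e1])
  -- points landing in B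
  have F0 : ∀ a, ‖a - p‖ ≤ r → f a ∈ B → a = x := by
    intro a ha hfa
    exact hinj ((hBn _ hfa).2 (hM a ha (hBn _ hfa).1))
  have F2 : ∀ b ∈ B, f b ∈ B → b = x := fun b hb => F0 b (hBn b hb).1
  have hpB' : ∀ b ∈ B, f b ≠ p := by
    intro b hb h
    have := hM b (hBn b hb).1 (by rw [h]; simpa using hr0.le)
    rw [h] at this
    simp at this
    linarith
  have cA' : ∀ a b : ℂ, IsPreconnected (segment ℝ a b) := fun a b =>
    (convex_segment a b).isPreconnected
  have hBc : IsPreconnected B :=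
    (cA' p c).union c (right_mem_segment _ _ _) (left_mem_segment _ _ _) (cA' c (f x))
  have hBk : IsCompact B := (isCompact_segment' _ _).union (isCompact_segment' _ _)
  -- fact 3
  have F3 : ∀ a ∈ A, f (f a) ∉ B := by
    intro a ha hb
    by_cases hax : a = x
    · subst hax
      exact hf.2 a (F2 _ hyB hb)
    have hxB : x ∉ B := by
      intro h
      have := hAB x hxA h
      rw [this] at hA
      rw [hA, segment_same] at ha
      exact hax (by rw [this]; exact ha)
    have hA' : segment ℝ p a ⊆ A :=
      (convex_segment p x).segment_subset hpA ha
    have hxA' : x ∉ segment ℝ p a := by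
      intro h
      have h1 := (seg_norm h).1
      have h2 := seg_norm ha
      exact hax (h2.2 (le_antisymm h2.1 h1))
    refine closing IH hf (K := segment ℝ p a ∪ B) ((isCompact_segment' _ _).union hBk)
      ((cA' p a).union p (left_mem_segment _ _ _) hpB hBc) ?_
      (Or.inl (right_mem_segment ℝ p a)) (m := 2) (by norm_num) (by omega) (Or.inr hb)
    rintro z hz hfz
    have hzx : z ≠ x := by
      rintro rfl
      rcases hz with h | h
      · exact hxA' h
      · exact hxB h
    have hzn : ‖z - p‖ ≤ r := by
      rcases hz with h | h
      · exact (hAn z (hA' h)).1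
      · exact (hBn z h).1
    rcases hfz with h' | h'
    · have h1 := hM z hzn (hAn _ (hA' h')).1
      have := (hAn _ (hA' h')).2 h1
      exact hxA' (this ▸ h')
    · exact hzx (F0 z hzn h')
  -- small push
  let T : Set ℂ := f '' (B ∪ f '' A) ∪ (fun i => f^[i] p) '' (Finset.Ico 1 n : Set ℕ)
  have hAk : IsCompact A := isCompact_segment' _ _
  have hT : IsClosed T := by
    refine IsClosed.union ?_ ((Finset.finite_toSet _).image _).isClosed
    exact ((hBk.union (hAk.image hc)).image hc).isClosed
  have hpT : p ∉ T := by
    rintro (⟨z, hz | ⟨a, ha, rfl⟩, hzp⟩ | ⟨i, hi, hip⟩)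
    · exact hpB' z hz hzp
    · exact F3 a ha (by rw [hzp]; exact hpB)
    · simp at hi
      exact IH i hi.1 hi.2 f hf p hip
  obtain ⟨U, hUo, hpU, hU⟩ := exists_free_nhd hc (K := {p}) isCompact_singleton (by
    rintro z rfl; exact hf.2 z)
  have hVo : IsOpen (U ∩ Tᶜ) := hUo.inter hT.isOpen_compl
  obtain ⟨ρ, hρ, hρV⟩ := Metric.isOpen_iff.1 hVo p ⟨hpU rfl, hpT⟩
  obtain ⟨q, hqseg, hqp, hqρ⟩ : ∃ q ∈ segment ℝ p c, p ∉ segment ℝ q c ∧ dist q p < ρ := by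
    have hev : ∀ᶠ t in 𝓝[>] (0 : ℝ), dist (AffineMap.lineMap p c t : ℂ) p < ρ := by
      have : Continuous fun t : ℝ => dist (AffineMap.lineMap p c t : ℂ) p := by fun_prop
      apply (this.tendsto 0).mono_left nhdsWithin_le_nhds |>.eventually_lt_const
      simpa using hρ
    have hev2 : ∀ᶠ t in 𝓝[>] (0 : ℝ), t ∈ Ioo (0 : ℝ) 1 := Ioo_mem_nhdsGT one_pos
    obtain ⟨t, ht, ht0, ht1⟩ := (hev.and hev2).exists
    refine ⟨AffineMap.lineMap p c t, ?_, ?_, ht⟩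
    · rw [segment_eq_image_lineMap]; exact ⟨t, ⟨ht0.le, ht1.le⟩, rfl⟩
    · intro h
      rw [segment_symm] at h
      have h1 := (seg_norm h).1
      have e : (AffineMap.lineMap p c t : ℂ) - c = ((1 - t : ℝ) : ℂ) * (p - c) := by
        simp [AffineMap.lineMap_apply]; ring
      rw [e, norm_mul, Complex.norm_real, Real.norm_eq_abs, abs_of_pos (by linarith)] at h1
      have : 0 < ‖p - c‖ := norm_pos_iff.2 (sub_ne_zero.2 hcp.symm)
      nlinarith
  obtain ⟨g, hg, hgU, hgp⟩ := push_local p q ρ hqρ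
  have hgood : PGood (g ∘ f) :=
    good_push hf hg hgU fun z hz h => hU z (hρV hz).1 (hρV h).1
  have hiter := iter_agree (f := f) hgU p n (by
    intro i hi hi' h
    exact (hρV h).2 (Or.inr ⟨i, by simp [hi, hi'], rfl⟩))
  set B' := segment ℝ q c ∪ segment ℝ c (f x) with hB'
  have hB'B : B' ⊆ B := by
    refine union_subset_union_left _ ?_
    exact (convex_segment p c).segment_subset hqseg (right_mem_segment _ _ _)
  have hpB'' : p ∉ B' := by
    rintro (h | h)
    · exact hqp h
    · exact hpc h
  have hgf : ∀ z ∈ B ∪ f '' A, g (f z) = f z := by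
    intro z hz
    exact hgU _ fun h => (hρV h).2 (Or.inl ⟨z, hz, rfl⟩)
  have h1 : (g ∘ f)^[1] p = f p := hiter 1 (by omega)
  have hlast : (g ∘ f)^[n - 1] (f p) = q := by
    have h2 : (g ∘ f)^[n] p = q := by
      obtain ⟨k, rfl⟩ : ∃ k, n = k + 1 := ⟨n - 1, by omega⟩
      rw [iterate_succ_apply', hiter k (by omega), comp_apply, ← iterate_succ_apply' f, hper, hgp]
    rw [← h1, ← iterate_add_apply, Nat.sub_add_cancel (by omega), h2]
  have hB'c : IsPreconnected B' :=
    (cA' q c).union c (right_mem_segment _ _ _) (left_mem_segment _ _ _) (cA' c (f x))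
  have hB'k : IsCompact B' := (isCompact_segment' _ _).union (isCompact_segment' _ _)
  refine closing IH hgood (K := B' ∪ f '' A) (hB'k.union (hAk.image hc))
    (hB'c.union (f x) (Or.inr (right_mem_segment _ _ _)) ⟨x, hxA, rfl⟩
      ((cA' p x).image f hc.continuousOn)) ?_
    (Or.inr ⟨p, hpA, rfl⟩ : f p ∈ _) (m := n - 1) (by omega) (by omega) ?_
  · intro z hz
    rw [comp_apply, hgf z (union_subset_union_left _ hB'B hz)]
    rintro hfz
    rcases hz with hz | ⟨a, ha, rfl⟩
    · rcases hfz with hfz | ⟨a, ha, hfa⟩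
      · have hzx := F2 z (hB'B hz) (hB'B hfz)
        have := hAB z (hzx ▸ hxA) (hB'B hz)
        exact hpB'' (this ▸ hz)
      · have := hinj hfa
        subst this
        have := hAB a ha (hB'B hz)
        exact hpB'' (this ▸ hz)
    · rcases hfz with hfz | ⟨a', ha', hfa⟩
      · exact F3 a ha (hB'B hfz)
      · exact F1 a ha (hinj hfa ▸ ha')
  · rw [hlast]
    exact Or.inl (Or.inl (left_mem_segment _ _ _))

lemma main_thm : ∀ n, 1 ≤ n → ∀ f, PGood f → ∀ p, f^[n] p ≠ p := by
  intro n
  induction n using Nat.strong_induction_on with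
  | _ n ih =>
    intro hn f hf p
    rcases Nat.lt_or_ge n 3 with h | h
    · interval_cases n
      · exact hf.2 p
      · exact no_period_two hf p
    · exact main_step h (fun m hm hmn => ih m hmn hm) hf p

/-- Murthy: an orientation-preserving topological embedding of the plane with a
periodic point has a fixed point. -/
theorem stmt0 (f : Plane → Plane)
    (hf : IsOrientationPreservingEmbedding f)
    (hper : ∃ p : Plane, ∃ n : ℕ, 1 ≤ n ∧ f^[n] p = p) :
    {p : Plane | f p = p}.Nonempty := by
  obtain ⟨-, F, hc, hi, h0, h1⟩ := hf
  obtain ⟨p, n, hn, hp⟩ := hper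
  by_contra hne
  have hfix : ∀ x, f x ≠ x := fun x hx => hne ⟨x, hx⟩
  let e : Plane ≃ₜ ℂ := Complex.orthonormalBasisOneI.repr.symm.toHomeomorph
  have hsemi : Semiconj e f (e ∘ f ∘ e.symm) := fun x => by simp
  refine main_thm n hn (e ∘ f ∘ e.symm) ⟨⟨fun t => e ∘ F t ∘ e.symm, ?_, ?_, ?_, ?_⟩, ?_⟩ (e p) ?_
  · exact e.continuous.comp (hc.comp
      (continuous_fst.prodMk (e.symm.continuous.comp continuous_snd)))
  · exact fun t => e.injective.comp ((hi t).injective.comp e.symm.injective)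
  · funext x; simp [h0]
  · simp only [h1]
  · intro x hx
    apply hfix (e.symm x)
    apply e.injective
    simpa using hx
  · rw [← (hsemi.iterate_right n).eq, hp]
end
end

section
/- Let f : ℝ² → ℝ² be an orientation-preserving topological embedding. If the non-wandering set Ω(f) is nonempty, then the set Fix(f) of fixed points of f is nonempty. -/
open Topology Filter Metric Set Function

noncomputable section

/-- The non-wandering set of `f`: points `x` such that every neighborhood `U` of `x`
contains a point `q` with `f^[n] q ∈ U` for some integer `n > 2`. -/
def nonWanderingSet (f : Plane → Plane) : Set Plane :=
  {x | ∀ U ∈ 𝓝 x, ∃ q ∈ U, ∃ n : ℕ, 2 < n ∧ f^[n] q ∈ U}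


theorem exists_log {A : Type*} [TopologicalSpace A] [SimplyConnectedSpace A]
    [LocallyPathConnectedSpace A] (G : A → ℂ) (hG : Continuous G) (h0 : ∀ a, G a ≠ 0) :
    ∃ M : A → ℂ, Continuous M ∧ ∀ a, Complex.exp (M a) = G a := by
  have a₀ : A := Classical.arbitrary A
  rcases Complex.isCoveringMapOn_exp.existsUnique_continuousMap_lifts
    ⟨G, hG⟩ (a₀ := a₀) (Complex.exp_log (h0 a₀)) (fun x ↦ h0 x) with ⟨M, ⟨-, hM⟩, -⟩
  exact ⟨M, M.continuous, fun a => congrFun hM a⟩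

theorem const_of_exp {A : Type*} [TopologicalSpace A] [PreconnectedSpace A] (φ : A → ℂ)
    (hφ : Continuous φ) (c : ℂ) (h : ∀ a, Complex.exp (φ a) = c) (a b : A) : φ a = φ b :=
  Complex.isCoveringMap_exp.const_of_comp hφ
    (fun a a' => Subtype.ext ((h a).trans (h a').symm)) a b

abbrev toC : Plane ≃ₗᵢ[ℝ] ℂ := Complex.orthonormalBasisOneI.repr.symm

theorem wind (G : ℝ → ℝ → ℂ) (hG : Continuous (fun p : ℝ × ℝ => G p.1 p.2))
    (h0 : ∀ s θ, G s θ ≠ 0) (hp : ∀ s, G s (2 * Real.pi) = G s 0)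
    (L : ℝ → ℂ) (hL : Continuous L) (hLG : ∀ θ, Complex.exp (L θ) = G 0 θ) :
    ∃ L' : ℝ → ℂ, Continuous L' ∧ (∀ θ, Complex.exp (L' θ) = G 1 θ) ∧
      L' (2 * Real.pi) - L' 0 = L (2 * Real.pi) - L 0 := by
  obtain ⟨M, hM, hMG⟩ := exists_log (fun p : ℝ × ℝ => G p.1 p.2) hG (fun p => h0 _ _)
  refine ⟨fun θ => M (1, θ), by fun_prop, fun θ => hMG _, ?_⟩
  have h1 := const_of_exp (fun s : ℝ => M (s, 2 * Real.pi) - M (s, 0)) (by fun_prop) 1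
    (fun s => by rw [Complex.exp_sub, hMG, hMG]; simp only [hp]; exact div_self (h0 _ _)) 1 0
  have h2 := const_of_exp (fun θ : ℝ => M (0, θ) - L θ) (by fun_prop) 1
    (fun s => by rw [Complex.exp_sub, hMG, hLG]; exact div_self (h0 _ _)) (2 * Real.pi) 0
  beta_reduce at h1 h2
  linear_combination h1 + h2

def clamp (t : ℝ) : ℝ := max 0 (min t 1)

theorem clamp_cont : Continuous clamp := by unfold clamp; fun_prop
theorem clamp_nonneg (t : ℝ) : 0 ≤ clamp t := le_max_left _ _
theorem clamp_le (t : ℝ) : clamp t ≤ 1 := max_le zero_le_one (min_le_right _ _)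
theorem clamp_zero : clamp 0 = 0 := by simp [clamp]
theorem clamp_one : clamp 1 = 1 := by simp [clamp]

theorem image_nhds (f : Plane → Plane) (hf : IsOrientationPreservingEmbedding f)
    (x : Plane) (r : ℝ) (hr : 0 < r) : f '' closedBall x r ∈ 𝓝 (f x) := by
  obtain ⟨hfe, F, hFc, hFe, hF0, hF1⟩ := hf
  have hcomp : IsCompact (f '' sphere x r) := (isCompact_sphere x r).image hfe.continuous
  have hnot : f x ∉ f '' sphere x r := by
    rintro ⟨y, hy, hyx⟩
    rw [hfe.injective hyx] at hy
    rw [mem_sphere, dist_self] at hy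
    exact hr.ne hy
  have hopen : (f '' sphere x r)ᶜ ∈ 𝓝 (f x) := hcomp.isClosed.isOpen_compl.mem_nhds hnot
  obtain ⟨ε, hε, hball⟩ := Metric.mem_nhds_iff.1 hopen
  refine Metric.mem_nhds_iff.2 ⟨ε, hε, fun w hw => ?_⟩
  by_contra hwn
  have hfc := hfe.continuous
  let c : ℝ → Plane := fun θ => toC.symm (r * Complex.exp (θ * Complex.I))
  have hc : Continuous c := by
    apply toC.symm.continuous.comp; fun_prop
  have hc2 : c (2 * Real.pi) = c 0 := by
    simp [c, Complex.exp_two_pi_mul_I]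
  have hcn : ∀ θ, ‖c θ‖ = r := fun θ => by
    simp only [c, LinearIsometryEquiv.norm_map, norm_mul, Complex.norm_exp_ofReal_mul_I]
    simp [abs_of_pos hr]
  have hcs : ∀ θ, x + c θ ∈ sphere x r := fun θ => by simp [hcn]
  obtain ⟨L1, hL1, hL1e, hL1d⟩ := wind (fun t θ => toC (F t (x + c θ) - F t x))
    (by
      apply toC.continuous.comp
      exact (hFc.comp (by fun_prop : Continuous fun p : ℝ × ℝ => (p.1, x + c p.2))).sub
        (hFc.comp (by fun_prop : Continuous fun p : ℝ × ℝ => (p.1, x))))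
    (by
      intro t θ h
      have h' := toC.map_eq_zero_iff.1 h
      have := (hFe t).injective (sub_eq_zero.1 h')
      have h3 : c θ = 0 := by simpa using this
      have := hcn θ
      rw [h3] at this; simp at this; exact hr.ne this)
    (fun s => by simp only [hc2])
    (fun θ => Real.log r + θ * Complex.I) (by fun_prop)
    (by
      intro θ
      rw [Complex.exp_add, ← Complex.ofReal_exp, Real.exp_log hr, hF0]
      simp [c])
  obtain ⟨L2, hL2, hL2e, hL2d⟩ := wind
    (fun t θ => toC (f (x + c θ) - (f x + clamp t • (w - f x))))
    (by
      have := clamp_cont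
      apply toC.continuous.comp; fun_prop)
    (by
      intro t θ h
      have h' := sub_eq_zero.1 (toC.map_eq_zero_iff.1 h)
      have h1 : f (x + c θ) ∈ ball (f x) ε := by
        rw [h', mem_ball, dist_eq_norm, add_sub_cancel_left, norm_smul, Real.norm_eq_abs,
          abs_of_nonneg (clamp_nonneg t)]
        rw [mem_ball, dist_eq_norm] at hw
        calc _ ≤ 1 * ‖w - f x‖ := by gcongr; exact clamp_le t
          _ < ε := by simpa using hw
      exact hball h1 ⟨_, hcs θ, rfl⟩)
    (fun s => by simp only [hc2])
    L1 hL1 (by intro θ; rw [hL1e, hF1, clamp_zero]; simp)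
  obtain ⟨L3, hL3, hL3e, hL3d⟩ := wind
    (fun t θ => toC (f (x + clamp (1 - t) • c θ) - w))
    (by
      have := clamp_cont
      apply toC.continuous.comp; fun_prop)
    (by
      intro t θ h
      have h' := sub_eq_zero.1 (toC.map_eq_zero_iff.1 h)
      apply hwn
      refine ⟨_, ?_, h'⟩
      rw [mem_closedBall, dist_eq_norm, add_sub_cancel_left, norm_smul, Real.norm_eq_abs,
          abs_of_nonneg (clamp_nonneg _), hcn]
      calc _ ≤ 1 * r := by gcongr; exact clamp_le _
        _ = r := one_mul _)
    (fun s => by simp only [hc2])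
    L2 hL2 (by intro θ; rw [hL2e]; simp [clamp_one])
  have h4 := const_of_exp L3 hL3 (toC (f x - w)) (fun θ => by rw [hL3e]; simp [clamp_zero])
    (2 * Real.pi) 0
  have h5 : L3 (2 * Real.pi) - L3 0 = 2 * Real.pi * Complex.I := by
    rw [hL3d, hL2d, hL1d]; push_cast; ring
  rw [h4, sub_self] at h5
  exact Complex.two_pi_I_ne_zero h5.symm

theorem isOpenMap_of (f : Plane → Plane) (hf : IsOrientationPreservingEmbedding f) :
    IsOpenMap f := by
  rw [isOpenMap_iff_nhds_le]
  intro x s hs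
  obtain ⟨ε, hε, h⟩ := Metric.mem_nhds_iff.1 (mem_map.1 hs)
  refine mem_of_superset (image_nhds f hf x (ε/2) (by positivity)) ?_
  rintro _ ⟨y, hy, rfl⟩
  exact h (closedBall_subset_ball (by linarith) hy)

/-- period two -/
theorem no_period_two_s1 (f : Plane → Plane) (hf : IsOrientationPreservingEmbedding f)
    (hfix : ∀ x, f x ≠ x) (a : Plane) (ha : f (f a) = a) : False := by
  obtain ⟨hfe, F, hFc, hFe, hF0, hF1⟩ := hf
  have hfc := hfe.continuous
  obtain ⟨M, hM, hMG⟩ := exists_log (fun p : ℝ × Plane => toC (F p.1 (f p.2) - F p.1 p.2))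
    (by
      apply toC.continuous.comp
      exact (hFc.comp (by fun_prop : Continuous fun p : ℝ × Plane => (p.1, f p.2))).sub hFc)
    (by
      rintro ⟨t, z⟩ h
      exact hfix z ((hFe t).injective (sub_eq_zero.1 (toC.map_eq_zero_iff.1 h))))
  have hne : ∀ t z, toC (F t (f z) - F t z) ≠ 0 := by
      rintro t z h
      exact hfix z ((hFe t).injective (sub_eq_zero.1 (toC.map_eq_zero_iff.1 h)))
  have hneg : ∀ t, Complex.exp (M (t, f a) - M (t, a)) = -1 := by
    intro t
    rw [Complex.exp_sub, hMG, hMG, div_eq_iff (hne _ _)]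
    simp only [ha]
    rw [← neg_sub, map_neg]; ring
  have h1 := const_of_exp (fun t : ℝ => M (t, f a) - M (t, a)) (by fun_prop) _ hneg 1 0
  have h2 := const_of_exp (fun z : Plane => M (1, z) - M (0, f z)) (by fun_prop) 1
    (fun z => by
      rw [Complex.exp_sub, hMG, hMG, div_eq_iff (by exact hne _ _)]
      simp [hF0, hF1]) a (f a)
  simp only [ha] at h1 h2
  have h3 : M (0, f a) - M (0, a) = 0 := by linear_combination (-1/2) * (h1 + h2)
  have := hneg 0
  rw [h3, Complex.exp_zero] at this
  norm_num at this

theorem ope_comp {g f : Plane → Plane} (hg : IsOrientationPreservingEmbedding g)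
    (hf : IsOrientationPreservingEmbedding f) : IsOrientationPreservingEmbedding (g ∘ f) := by
  obtain ⟨hge, G, hGc, hGe, hG0, hG1⟩ := hg
  obtain ⟨hfe, F, hFc, hFe, hF0, hF1⟩ := hf
  refine ⟨hge.comp hfe, fun t => G t ∘ F t, ?_, fun t => (hGe t).comp (hFe t), ?_, ?_⟩
  · exact hGc.comp (continuous_fst.prodMk hFc)
  · simp [hG0, hF0]
  · simp [hG1, hF1]

theorem push_ball (x y : Plane) (R : ℝ) (hy : y ∈ ball x R) :
    ∃ h : Plane → Plane, IsOrientationPreservingEmbedding h ∧ (∀ z ∉ ball x R, h z = z) ∧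
      h x = y := by
  have hR : 0 < R := dist_nonneg.trans_lt hy
  set v : Plane := R⁻¹ • (y - x) with hv
  have hv1 : ‖v‖ < 1 := by
    rw [hv, norm_smul, norm_inv, Real.norm_eq_abs, abs_of_pos hR, inv_mul_lt_iff₀ hR, mul_one,
      ← dist_eq_norm]
    exact hy
  let H : ℝ → Plane → Plane := fun t z => z + (clamp t * max 0 (R - dist z x)) • v
  have hHc : Continuous (fun q : ℝ × Plane => H q.1 q.2) := by
    have := clamp_cont
    fun_prop
  have hHe : ∀ t, IsEmbedding (H t) := by
    intro t
    have hanti : AntilipschitzWith (Real.toNNReal (1 - ‖v‖)⁻¹) (H t) := by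
      apply AntilipschitzWith.of_le_mul_dist
      intro z w
      have h1 : 0 < 1 - ‖v‖ := by linarith
      rw [Real.coe_toNNReal _ (inv_nonneg.2 h1.le)]
      rw [le_inv_mul_iff₀ h1]
      have h2 : |max 0 (R - dist z x) - max 0 (R - dist w x)| ≤ dist z w := by
        refine (abs_max_sub_max_le_max _ _ _ _).trans ?_
        rw [sub_self, abs_zero]
        refine max_le dist_nonneg ?_
        have : R - dist z x - (R - dist w x) = dist w x - dist z x := by ring
        rw [this, dist_comm z w]
        exact abs_dist_sub_le w z x
      set a := max 0 (R - dist z x)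
      set b := max 0 (R - dist w x)
      have h3 : z - w = (H t z - H t w) - (clamp t * (a - b)) • v := by
        simp only [H, a, b, mul_sub, sub_smul]; abel
      have h4 : ‖(clamp t * (a - b)) • v‖ ≤ dist z w * ‖v‖ := by
        rw [norm_smul, norm_mul, Real.norm_eq_abs, Real.norm_eq_abs,
          abs_of_nonneg (clamp_nonneg t)]
        gcongr
        calc _ ≤ 1 * dist z w := by
              gcongr
              exact clamp_le t
          _ = _ := one_mul _
      have h5 : dist z w ≤ dist (H t z) (H t w) + dist z w * ‖v‖ := by
        calc dist z w = ‖z - w‖ := dist_eq_norm _ _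
          _ ≤ ‖H t z - H t w‖ + ‖(clamp t * (a - b)) • v‖ := by
            rw [h3]; exact norm_sub_le _ _
          _ ≤ _ := by rw [dist_eq_norm (H t z)]; gcongr
      linarith
    have hcont : Continuous (H t) := by simp only [H]; fun_prop
    refine ⟨?_, hanti.injective⟩
    have hlip : LipschitzWith (1 + 1 * 1) (H t) := by
      apply LipschitzWith.of_dist_le_mul
      intro z w
      have h2 : |max 0 (R - dist z x) - max 0 (R - dist w x)| ≤ dist z w := by
        refine (abs_max_sub_max_le_max _ _ _ _).trans ?_
        rw [sub_self, abs_zero]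
        refine max_le dist_nonneg ?_
        have : R - dist z x - (R - dist w x) = dist w x - dist z x := by ring
        rw [this, dist_comm z w]
        exact abs_dist_sub_le w z x
      set a := max 0 (R - dist z x)
      set b := max 0 (R - dist w x)
      have h3 : H t z - H t w = (z - w) + (clamp t * (a - b)) • v := by
        simp only [H, a, b, mul_sub, sub_smul]; abel
      have h4 : ‖(clamp t * (a - b)) • v‖ ≤ dist z w * 1 := by
        rw [norm_smul, norm_mul, Real.norm_eq_abs, Real.norm_eq_abs,
          abs_of_nonneg (clamp_nonneg t)]
        gcongr
        calc _ ≤ 1 * dist z w := by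
              gcongr
              exact clamp_le t
          _ = _ := one_mul _
      rw [dist_eq_norm, h3]
      refine (norm_add_le _ _).trans ?_
      rw [← dist_eq_norm]
      push_cast
      linarith
    exact (hanti.isUniformEmbedding hlip.uniformContinuous).isEmbedding.isInducing
  refine ⟨H 1, ⟨hHe 1, H, hHc, hHe, ?_, rfl⟩, ?_, ?_⟩
  · ext1 z; simp [H, clamp_zero]
  · intro z hz
    have : R - dist z x ≤ 0 := by
      rw [mem_ball, not_lt] at hz; linarith
    simp [H, max_eq_left this]
  · simp only [H, clamp_one, dist_self, sub_zero, max_eq_right hR.le, one_mul, hv]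
    rw [smul_inv_smul₀ hR.ne']; abel

theorem push_s1 (V : Set Plane) (hV : IsOpen V) (hVc : IsPreconnected V) (p q : Plane) (hp : p ∈ V)
    (hq : q ∈ V) : ∃ h : Plane → Plane, IsOrientationPreservingEmbedding h ∧
      (∀ z ∉ V, h z = z) ∧ h p = q := by
  refine hVc.induction₂' (fun p q => ∃ h : Plane → Plane, IsOrientationPreservingEmbedding h ∧
      (∀ z ∉ V, h z = z) ∧ h p = q) ?_ ?_ hp hq
  · intro x hx
    obtain ⟨R, hR, hRV⟩ := Metric.isOpen_iff.1 hV x hx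
    apply mem_nhdsWithin_of_mem_nhds
    filter_upwards [ball_mem_nhds x (half_pos hR)] with y hy
    constructor
    · obtain ⟨h, h1, h2, h3⟩ := push_ball x y R (ball_subset_ball (by linarith) hy)
      exact ⟨h, h1, fun z hz => h2 z (fun hz' => hz (hRV hz')), h3⟩
    · obtain ⟨h, h1, h2, h3⟩ := push_ball y x (R / 2) (mem_ball_comm.1 hy)
      refine ⟨h, h1, fun z hz => h2 z (fun hz' => hz (hRV ?_)), h3⟩
      rw [mem_ball] at *
      linarith [dist_triangle z y x]
  · rintro x y z - - - ⟨h, h1, h2, h3⟩ ⟨k, k1, k2, k3⟩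
    refine ⟨k ∘ h, ope_comp k1 h1, fun w hw => ?_, ?_⟩
    · simp [h2 w hw, k2 w hw]
    · simp [h3, k3]

theorem perturb_fix {f h : Plane → Plane} (hh : IsOrientationPreservingEmbedding h)
    {V : Set Plane} (hV : ∀ z ∉ V, h z = z) (hfree : ∀ z ∈ V, f z ∉ V) (hfix : ∀ z, f z ≠ z) :
    ∀ z, (h ∘ f) z ≠ z := by
  intro z hz
  simp only [comp_apply] at hz
  by_cases h1 : f z ∈ V
  · by_cases h2 : z ∈ V
    · exact hfree z h2 h1
    · have := hh.1.injective (hz.trans (hV z h2).symm)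
      exact hfix z this
  · rw [hV _ h1] at hz; exact hfix z hz

theorem perturb_iter {f h : Plane → Plane} {V : Set Plane} (hV : ∀ z ∉ V, h z = z) (p : Plane)
    (k : ℕ) (hk : 1 ≤ k) (hi : ∀ i, 1 ≤ i → i < k → f^[i] p ∉ V) :
    (h ∘ f)^[k] p = h (f^[k] p) := by
  induction k, hk using Nat.le_induction with
  | base => simp
  | succ k hk ih =>
    rw [iterate_succ_apply', ih (fun i h1 h2 => hi i h1 (by omega)),
      hV _ (hi k hk (by omega)), comp_apply, ← iterate_succ_apply' f]

theorem closing_s1 {f : Plane → Plane} (hf : IsOrientationPreservingEmbedding f)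
    (hfix : ∀ z, f z ≠ z) {V : Set Plane} (hV : IsOpen V) (hVc : IsPreconnected V)
    (hfree : ∀ z ∈ V, f z ∉ V) {p : Plane} (hp : p ∈ V) {k : ℕ} (hk : 1 ≤ k)
    (hkV : f^[k] p ∈ V) : ∃ j ≤ k, 2 ≤ j ∧ ∃ g : Plane → Plane,
      IsOrientationPreservingEmbedding g ∧ (∀ z, g z ≠ z) ∧ g^[j] p = p := by
  classical
  have hex : ∃ j, 1 ≤ j ∧ f^[j] p ∈ V := ⟨k, hk, hkV⟩
  obtain ⟨h1, h2⟩ := Nat.find_spec hex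
  have hmin : ∀ i, 1 ≤ i → i < Nat.find hex → f^[i] p ∉ V :=
    fun i hi hlt hiV => Nat.find_min hex hlt ⟨hi, hiV⟩
  have hle : Nat.find hex ≤ k := Nat.find_min' hex ⟨hk, hkV⟩
  generalize Nat.find hex = j at *
  obtain ⟨h, hh, hhV, hhp⟩ := push_s1 V hV hVc _ _ h2 hp
  refine ⟨j, hle, ?_, h ∘ f, ope_comp hh hf, perturb_fix hh hhV hfree hfix, ?_⟩
  · by_contra hj
    have : j = 1 := by omega
    subst this
    exact hfree p hp h2
  · rw [perturb_iter hhV p j h1 hmin, hhp]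

set_option maxHeartbeats 1600000 in
theorem no_periodic (f₀ : Plane → Plane) (hf₀ : IsOrientationPreservingEmbedding f₀)
    (hfix₀ : ∀ z, f₀ z ≠ z) (p₀ : Plane) (n₀ : ℕ) (hn₀ : 2 ≤ n₀) (hp₀ : f₀^[n₀] p₀ = p₀) :
    False := by
  classical
  have hex : ∃ n, 2 ≤ n ∧ ∃ f : Plane → Plane, IsOrientationPreservingEmbedding f ∧
      (∀ z, f z ≠ z) ∧ ∃ x, f^[n] x = x := ⟨n₀, hn₀, f₀, hf₀, hfix₀, p₀, hp₀⟩
  obtain ⟨N, ⟨hN2, f, hf, hfix, x, hx⟩, hNmin⟩ : ∃ N, (2 ≤ N ∧ ∃ f : Plane → Plane,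
      IsOrientationPreservingEmbedding f ∧ (∀ z, f z ≠ z) ∧ ∃ x, f^[N] x = x) ∧
      ∀ m, m < N → ¬ (2 ≤ m ∧ ∃ f : Plane → Plane, IsOrientationPreservingEmbedding f ∧
      (∀ z, f z ≠ z) ∧ ∃ x, f^[m] x = x) :=
    ⟨Nat.find hex, Nat.find_spec hex, fun m => Nat.find_min hex⟩
  have star : ∀ (g : Plane → Plane), IsOrientationPreservingEmbedding g → (∀ z, g z ≠ z) →
      ∀ V : Set Plane, IsOpen V → IsPreconnected V → (∀ z ∈ V, g z ∉ V) → ∀ p ∈ V, ∀ k, 1 ≤ k →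
      k < N → g^[k] p ∉ V := by
    intro g hg hgf V hV hVc hVf p hp k hk hkN hkV
    obtain ⟨j, hjk, hj2, g', hg', hgf', hj⟩ := closing_s1 hg hgf hV hVc hVf hp hk hkV
    exact hNmin j (lt_of_le_of_lt hjk hkN) ⟨hj2, g', hg', hgf', p, hj⟩
  have hN3 : 3 ≤ N := by
    rcases Nat.lt_or_ge N 3 with h | h
    · have : N = 2 := by omega
      subst this
      exact (no_period_two_s1 f hf hfix x hx).elim
    · exact h
  have hfc := hf.1.continuous
  -- the critical ball
  obtain ⟨y, -, hy⟩ := (isCompact_closedBall x (dist (f x) x)).exists_isMinOn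
    ⟨x, mem_closedBall_self dist_nonneg⟩
    (f := fun z => max (dist z x) (dist (f z) x)) (by fun_prop)
  set r := max (dist y x) (dist (f y) x) with hr
  have hmin : ∀ z, r ≤ max (dist z x) (dist (f z) x) := by
    intro z
    by_cases hz : z ∈ closedBall x (dist (f x) x)
    · exact hy hz
    · have h1 := hy (mem_closedBall_self dist_nonneg : x ∈ closedBall x (dist (f x) x))
      simp only [Set.mem_ofPred_eq, dist_self, max_eq_right dist_nonneg] at h1
      rw [mem_closedBall, not_le] at hz
      exact (h1.trans hz.le).trans (le_max_left _ _)
  have hyB : y ∈ closedBall x r := mem_closedBall.2 (le_max_left _ _)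
  have hfyB : f y ∈ closedBall x r := mem_closedBall.2 (le_max_right _ _)
  have hr0 : 0 < r := by
    by_contra h
    have h1 : dist y x ≤ 0 := (le_max_left _ _).trans (not_lt.1 h)
    have h2 : dist (f y) x ≤ 0 := (le_max_right _ _).trans (not_lt.1 h)
    rw [dist_le_zero] at h1 h2
    exact hfix y (h2.trans h1.symm)
  clear_value r
  have hcl : closure (ball x r) = closedBall x r := closure_ball x hr0.ne'
  have A1 : ∀ z ∈ ball x r, f z ∉ ball x r := fun z hz hz' =>
    absurd (hmin z) (not_le.2 (max_lt hz hz'))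
  have A2 : ∀ z ∈ closedBall x r, f z ∉ ball x r := by
    rw [← hcl]
    exact closure_minimal (t := {z | f z ∉ ball x r}) A1 (isOpen_ball.isClosed_compl.preimage hfc)
  have A3 : ∀ z ∈ ball x r, f z ∉ closedBall x r := by
    have hd : Disjoint (f '' ball x r) (ball x r) := by
      rw [Set.disjoint_left]; rintro _ ⟨z, hz, rfl⟩; exact A1 z hz
    have hd' := hd.closure_right (isOpenMap_of f hf _ isOpen_ball)
    rw [hcl, Set.disjoint_left] at hd'
    exact fun z hz => hd' ⟨z, hz, rfl⟩
  have hBc : IsPreconnected (ball x r) := (convex_ball x r).isPreconnected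
  have A4 : ∀ z ∈ ball x r, f (f z) ∉ ball x r := fun z hz =>
    star f hf hfix _ isOpen_ball hBc A1 z hz 2 (by omega) (by omega)
  have A5 : ∀ z ∈ closedBall x r, f (f z) ∉ ball x r := by
    rw [← hcl]
    exact closure_minimal (t := {z | f (f z) ∉ ball x r}) A4
      (isOpen_ball.isClosed_compl.preimage (hfc.comp hfc))
  have hyr : ‖y - x‖ = r := by
    rw [← dist_eq_norm]
    exact le_antisymm hyB (not_lt.1 fun h => A3 y h hfyB)
  have hfyr : ‖f y - x‖ = r := by
    rw [← dist_eq_norm]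
    exact le_antisymm hfyB (not_lt.1 (A2 y hyB))
  -- radii
  have hray : ∀ u : Plane, ‖u - x‖ = r → ∀ s : ℝ, 0 ≤ s → s ≤ 1 →
      x + s • (u - x) ∈ ball x r ∨ x + s • (u - x) = u := by
    intro u hu s h0 h1
    rcases h1.lt_or_eq with h | h
    · left
      rw [mem_ball, dist_eq_norm, add_sub_cancel_left, norm_smul, hu, Real.norm_eq_abs,
        abs_of_nonneg h0]
      nlinarith
    · right; rw [h]; simp
  let S1 : Set Plane := (fun s : ℝ => x + s • (f y - x)) '' Icc (1/4) 1
  let S2 : Set Plane := (fun s : ℝ => x + s • (y - x)) '' Icc 0 1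
  have S1B : ∀ w ∈ S1, w ∈ ball x r ∨ w = f y := by
    rintro _ ⟨s, hs, rfl⟩; exact hray _ hfyr s (by linarith [hs.1]) hs.2
  have S2B : ∀ w ∈ S2, w ∈ ball x r ∨ w = y := by
    rintro _ ⟨s, hs, rfl⟩; exact hray _ hyr s hs.1 hs.2
  have S1C : ∀ w ∈ S1, w ∈ closedBall x r := fun w hw =>
    (S1B w hw).elim (fun h => ball_subset_closedBall h) (fun h => h ▸ hfyB)
  have S2C : ∀ w ∈ S2, w ∈ closedBall x r := fun w hw =>
    (S2B w hw).elim (fun h => ball_subset_closedBall h) (fun h => h ▸ hyB)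
  have yS2 : y ∈ S2 := ⟨1, by norm_num, by simp⟩
  have xS2 : x ∈ S2 := ⟨0, by norm_num, by simp⟩
  have fyS1 : f y ∈ S1 := ⟨1, by norm_num, by simp⟩
  have S12 : ∀ w ∈ S1, w ∉ S2 := by
    rintro _ ⟨s, hs, rfl⟩ ⟨s', hs', he⟩
    have he' : s' • (y - x) = s • (f y - x) := by simpa using he
    have hn := congrArg norm he'
    rw [norm_smul, norm_smul, hyr, hfyr, Real.norm_eq_abs, Real.norm_eq_abs,
      abs_of_nonneg hs'.1, abs_of_nonneg (by linarith [hs.1])] at hn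
    have hss : s' = s := mul_right_cancel₀ hr0.ne' hn
    rw [hss] at he'
    have hs0 : s ≠ 0 := by have := hs.1; intro h; rw [h] at this; norm_num at this
    have := smul_right_injective Plane hs0 he'
    exact hfix y (by simpa using this.symm)
  let K : Set Plane := S1 ∪ f '' S2
  have S1comp : IsCompact S1 := isCompact_Icc.image (by fun_prop)
  have S2comp : IsCompact S2 := isCompact_Icc.image (by fun_prop)
  have Kcomp : IsCompact K := S1comp.union (S2comp.image hfc)
  have S1conn : IsPreconnected S1 := isPreconnected_Icc.image _ (by fun_prop)
  have S2conn : IsPreconnected S2 := isPreconnected_Icc.image _ (by fun_prop)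
  have Kconn : IsPreconnected K := IsPreconnected.union (f y) fyS1 ⟨y, yS2, rfl⟩ S1conn
    (S2conn.image _ hfc.continuousOn)
  have hCB : closedBall x (r/2) ⊆ ball x r := closedBall_subset_ball (by linarith)
  have hinj := hf.1.injective
  have hdisj : Disjoint (f '' K) (K ∪ closedBall x (r/2)) := by
    rw [Set.disjoint_left]
    rintro _ ⟨u, hu | ⟨z, hz, rfl⟩, rfl⟩ ((h | ⟨z', hz', h⟩) | h)
    · rcases S1B _ h with h | h
      · exact A2 u (S1C u hu) h
      · rw [hinj h] at hu; exact S12 _ hu yS2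
    · rw [hinj h] at hz'; exact S12 _ hu hz'
    · exact A2 u (S1C u hu) (hCB h)
    · rcases S1B _ h with h | h
      · exact A5 z (S2C z hz) h
      · have h := hinj h
        rcases S2B z hz with hzB | rfl
        · exact A3 z hzB (h ▸ hyB)
        · exact hfix _ h
    · have h := hinj h
      rcases S2B z' hz' with hzB | rfl
      · exact A2 z (S2C z hz) (h ▸ hzB)
      · rcases S2B z hz with hzB | rfl
        · exact A3 z hzB (h ▸ hyB)
        · exact hfix _ h.symm
    · exact A5 z (S2C z hz) (hCB h)
  obtain ⟨δ₁, hδ₁, hd₁⟩ := hdisj.exists_thickenings (Kcomp.image hfc)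
    (Kcomp.union (isCompact_closedBall x (r/2))).isClosed
  have hop : IsOpen (f ⁻¹' thickening δ₁ (f '' K)) := isOpen_thickening.preimage hfc
  have hsub : K ⊆ f ⁻¹' thickening δ₁ (f '' K) :=
    image_subset_iff.1 (self_subset_thickening hδ₁ (f '' K))
  obtain ⟨δ₂, hδ₂, hd₂⟩ := Kcomp.exists_thickening_subset_open hop hsub
  set V := thickening (min δ₁ δ₂) K with hVdef
  have hKV : K ⊆ V := self_subset_thickening (lt_min hδ₁ hδ₂) _
  have hVo : IsOpen V := isOpen_thickening
  have hVconn : IsPreconnected V := by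
    rw [hVdef, ← add_ball_zero, ← Set.image2_add, ← Set.image_prod]
    exact (Kconn.prod (convex_ball _ _).isPreconnected).image _ (by fun_prop)
  have hfV : ∀ z ∈ V, f z ∉ V ∧ f z ∉ closedBall x (r/2) := by
    intro z hz
    have h1 : f z ∈ thickening δ₁ (f '' K) := hd₂ (thickening_mono (min_le_right _ _) _ hz)
    have h2 := Set.disjoint_left.1 hd₁ h1
    refine ⟨fun h => h2 ?_, fun h => h2 ?_⟩
    · exact thickening_subset_of_subset _ subset_union_left
        (thickening_mono (min_le_left _ _) _ h)
    · exact self_subset_thickening hδ₁ _ (Or.inr h)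
  -- push x to x'
  let x' : Plane := x + (1/4 : ℝ) • (f y - x)
  have hx'V : x' ∈ V := hKV (Or.inl ⟨1/4, by norm_num, rfl⟩)
  have hx'U : x' ∈ ball x (r/2) := by
    rw [mem_ball, dist_eq_norm, add_sub_cancel_left, norm_smul, hfyr]
    norm_num; linarith
  have hUB : ball x (r/2) ⊆ ball x r := ball_subset_ball (by linarith)
  obtain ⟨h, hh, hhU, hhx⟩ := push_ball x x' (r/2) hx'U
  have hUfree : ∀ z ∈ ball x (r/2), f z ∉ ball x (r/2) := fun z hz hz' =>
    A1 z (hUB hz) (hUB hz')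
  have hit : ∀ i, 1 ≤ i → i < N → f^[i] x ∉ ball x (r/2) := fun i h1 h2 hi =>
    star f hf hfix _ isOpen_ball hBc A1 x (mem_ball_self hr0) i h1 h2 (hUB hi)
  have hgN := perturb_iter hhU x N (by omega) hit
  rw [hx, hhx] at hgN
  have hgV : ∀ z ∈ V, (h ∘ f) z ∉ V := by
    intro z hz
    rw [comp_apply, hhU _ (fun hh' => (hfV z hz).2 (ball_subset_closedBall hh'))]
    exact (hfV z hz).1
  have hfxV : f x ∈ V := hKV (Or.inr ⟨x, xS2, rfl⟩)
  have hgx : (h ∘ f) x = f x := hhU _ (hit 1 le_rfl (by omega))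
  refine star (h ∘ f) (ope_comp hh hf) (perturb_fix hh hhU hUfree hfix) V hVo hVconn hgV
    (f x) hfxV (N - 1) (by omega) (by omega) ?_
  rw [← hgx, ← iterate_succ_apply, Nat.succ_eq_add_one, Nat.sub_add_cancel (by omega), hgN]
  exact hx'V

/-- An orientation-preserving topological embedding of the plane with nonempty
non-wandering set has a fixed point. -/
theorem stmt1 (f : Plane → Plane)
    (hf : IsOrientationPreservingEmbedding f)
    (hΩ : (nonWanderingSet f).Nonempty) :
    {p : Plane | f p = p}.Nonempty := by
  by_contra hne
  have hfix : ∀ z, f z ≠ z := fun z hz => hne ⟨z, hz⟩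
  obtain ⟨x, hx⟩ := hΩ
  have hfc := hf.1.continuous
  obtain ⟨u, v, hu, hv, hfxu, hxv, huv⟩ := t2_separation (hfix x)
  have hW : v ∩ f ⁻¹' u ∈ 𝓝 x := (hv.inter (hu.preimage hfc)).mem_nhds ⟨hxv, hfxu⟩
  obtain ⟨ε, hε, hb⟩ := Metric.mem_nhds_iff.1 hW
  obtain ⟨q, hq, n, hn, hqn⟩ := hx (ball x ε) (ball_mem_nhds x hε)
  obtain ⟨j, -, hj2, g, hg, hgf, hgj⟩ := closing_s1 hf hfix isOpen_ball
    (convex_ball x ε).isPreconnected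
    (fun z hz hz' => Set.disjoint_left.1 huv (hb hz).2 (hb hz').1) hq (by omega) hqn
  exact no_periodic g hg hgf q j hj2 hgj
end
end

section
/- Let f : ℝ² → ℝ² be a differentiable map (not necessarily C¹). If for some ε > 0 one has Spec(f) ∩ [0, ε) = ∅, then f is a topological embedding; in particular f is injective. -/
open Topology Filter Metric Set Function

noncomputable section

/-- `z : ℂ` is a complex eigenvalue of the continuous `ℝ`-linear map `L : ℝ² → ℝ²`,
i.e. a root of the characteristic polynomial of its matrix in the standard basis. -/
def IsEigenvalueCLM (L : Plane →L[ℝ] Plane) (z : ℂ) : Prop :=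
  (((LinearMap.toMatrix (EuclideanSpace.basisFun (Fin 2) ℝ).toBasis
      (EuclideanSpace.basisFun (Fin 2) ℝ).toBasis) L.toLinearMap).map
      (algebraMap ℝ ℂ)).charpoly.IsRoot z

/-- `Spec` of a map whose derivative at each point `p` is `Df p`: the set of all complex
eigenvalues of all the derivatives. -/
def spec (Df : Plane → Plane →L[ℝ] Plane) : Set ℂ :=
  {z | ∃ p : Plane, IsEigenvalueCLM (Df p) z}


theorem min_lemma {E H : Type*} [NormedAddCommGroup E] [NormedSpace ℝ E] [ProperSpace E]
    [NormedAddCommGroup H] [InnerProductSpace ℝ H] {g : E → H} {g' : E → E →L[ℝ] H}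
    {x : E} {r : ℝ} {w : H} (hr : 0 < r)
    (hg : ∀ y ∈ closedBall x r, HasFDerivAt g (g' y) y)
    (hs : ∀ y ∈ closedBall x r, Surjective (g' y))
    (hw : ∀ y ∈ sphere x r, ‖g x - w‖ < ‖g y - w‖) : ∃ y ∈ ball x r, g y = w := by
  have hc : ContinuousOn (fun y => ‖g y - w‖ ^ 2) (closedBall x r) := by
    have : ContinuousOn g (closedBall x r) := fun y hy => (hg y hy).continuousAt.continuousWithinAt
    fun_prop
  obtain ⟨y, hy, hmin⟩ := (isCompact_closedBall x r).exists_isMinOn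
    ⟨x, mem_closedBall_self hr.le⟩ hc
  have hyb : y ∈ ball x r := by
    by_contra hcon
    have hys : y ∈ sphere x r := by
      rw [mem_sphere]; rw [mem_ball] at hcon; rw [mem_closedBall] at hy; linarith
    have h1 := hw y hys
    have h2 : ‖g y - w‖ ^ 2 ≤ ‖g x - w‖ ^ 2 := hmin (mem_closedBall_self hr.le)
    have := pow_lt_pow_left₀ h1 (norm_nonneg _) two_ne_zero
    linarith
  refine ⟨y, hyb, ?_⟩
  have hloc : IsLocalMin (fun y => ‖g y - w‖ ^ 2) y :=
    hmin.isLocalMin (mem_of_superset (isOpen_ball.mem_nhds hyb) ball_subset_closedBall)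
  have hd := ((hg y hy).sub_const w).norm_sq
  have h0 := hloc.hasFDerivAt_eq_zero hd
  obtain ⟨v, hv⟩ := hs y hy (g y - w)
  have := DFunLike.congr_fun h0 v
  have h5 : inner ℝ (g y - w) (g y - w) = 0 := by
    have h6 : 2 * inner ℝ (g y - w) (g' y v) = 0 := by simpa [inner_sub_left] using this
    rw [hv] at h6; linarith
  exact sub_eq_zero.mp (inner_self_eq_zero.1 h5)

section lifting
open unitInterval

variable {E X A : Type*} [TopologicalSpace E] [TopologicalSpace X] [TopologicalSpace A]
  [T2Space E] {p : E → X}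

theorem lift_open (hp : IsLocalHomeomorph p) (F : C(I × A, X)) (c : A → E) (hc : Continuous c)
    (h0 : ∀ a, p (c a) = F (0, a)) :
    IsOpen {a | ∃ γ : C(I, E), γ 0 = c a ∧ ∀ u, p (γ u) = F (u, a)} := by
  classical
  rw [isOpen_iff_mem_nhds]
  rintro a₀ ⟨γ, hγ0, hγ⟩
  let q : E ⊕ X → X := Sum.elim p id
  have hq : IsLocalHomeomorph q := by
    rw [isLocalHomeomorph_iff_isOpenEmbedding_restrict]
    have hp' := isLocalHomeomorph_iff_isOpenEmbedding_restrict.1 hp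
    rintro (e | x)
    · obtain ⟨U, hU, hUe⟩ := hp' e
      refine ⟨Sum.inl '' U, IsOpenMap.image_mem_nhds isOpenMap_inl hU, ?_⟩
      refine .of_continuous_injective_isOpenMap ?_ ?_ ?_
      · exact ((hp.continuous.sumElim continuous_id).comp continuous_subtype_val)
      · rintro ⟨_, a, ha, rfl⟩ ⟨_, b, hb, rfl⟩ hab
        have := @hUe.injective ⟨a, ha⟩ ⟨b, hb⟩ hab
        have h3 : a = b := by simpa using this
        subst h3; rfl
      · have ho : IsOpenMap q := hp.isOpenMap.sumElim IsOpenMap.id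
        have : ∃ U' ⊆ U, IsOpen U' ∧ e ∈ U' := mem_nhds_iff.1 hU
        intro s hs
        rw [isOpen_induced_iff] at hs
        obtain ⟨t, ht, rfl⟩ := hs
        have h2 : (Sum.inl '' U).domRestrict q '' (Subtype.val ⁻¹' t) = U.domRestrict p '' (Subtype.val ⁻¹' (Sum.inl ⁻¹' t)) := by
          ext y; constructor
          · rintro ⟨⟨_, a, ha, rfl⟩, hat, rfl⟩
            exact ⟨⟨a, ha⟩, hat, rfl⟩
          · rintro ⟨⟨a, ha⟩, hat, rfl⟩
            exact ⟨⟨Sum.inl a, a, ha, rfl⟩, hat, rfl⟩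
        rw [h2]
        exact hUe.isOpenMap _ ((ht.preimage continuous_inl).preimage continuous_subtype_val)
    · refine ⟨range Sum.inr, isOpen_range_inr.mem_nhds ⟨x, rfl⟩, ?_⟩
      refine .of_continuous_injective_isOpenMap ?_ ?_ ?_
      · exact ((hp.continuous.sumElim continuous_id).comp continuous_subtype_val)
      · rintro ⟨_, a, rfl⟩ ⟨_, b, rfl⟩ hab
        have : a = b := hab
        subst this; rfl
      · have ho : IsOpenMap q := hp.isOpenMap.sumElim IsOpenMap.id
        exact ho.domRestrict isOpen_range_inr
  let g : I × A → E ⊕ X := fun z => if z.2 = a₀ then Sum.inl (γ z.1) else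
    if z.1 = 0 then Sum.inl (c z.2) else Sum.inr (F z)
  have g_lifts : q ∘ g = F := by
    ext ⟨u, a⟩
    by_cases h1 : a = a₀
    · subst h1; simp [g, q, hγ]
    · by_cases h2 : u = 0
      · subst h2; simp [g, q, h1, h0]
      · simp [g, q, h1, h2]
  have g0 : ∀ a, g (0, a) = Sum.inl (c a) := by
    intro a
    by_cases h1 : a = a₀
    · subst h1; simp [g, hγ0]
    · simp [g, h1]
  obtain ⟨N, hN, g', hg', hqg, hg0, -⟩ := hq.exists_lift_nhds (f := F) (g := g) g_lifts
    (by simp only [g0]; fun_prop) a₀ (by simp only [g, if_true]; fun_prop)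
  filter_upwards [hN] with a ha
  have hcont : Continuous (fun u : I => g' (u, a)) :=
    hg'.comp_continuous (by fun_prop) (fun u => ⟨mem_univ _, ha⟩)
  have hr : ∀ u, g' (u, a) ∈ range (Sum.inl : E → E ⊕ X) := by
    have hcl : IsClopen ((fun u : I => g' (u, a)) ⁻¹' range Sum.inl) :=
      (show IsClopen (range (Sum.inl : E → E ⊕ X)) from ⟨isClosed_range_inl, isOpen_range_inl⟩).preimage hcont
    have := hcl.eq_univ ⟨0, by simp [hg0, g0]⟩
    intro u
    have hu : u ∈ (univ : Set I) := mem_univ u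
    rw [← this] at hu; exact hu
  choose γ' hγ' using hr
  have hγc : Continuous γ' := by
    refine (IsEmbedding.inl (X := E) (Y := X)).continuous_iff.2 ?_
    convert hcont using 1
    ext1 u; exact hγ' u
  refine ⟨⟨γ', hγc⟩, ?_, ?_⟩
  · have := hγ' 0
    rw [hg0, g0] at this
    exact Sum.inl_injective this
  · intro u
    have := congrFun hqg (u, a)
    simp only [comp_apply, ← hγ'] at this
    exact this

theorem lift_cont (hp : IsLocalHomeomorph p) (F : C(I × A, X)) (c : A → E) (hc : Continuous c)
    (h : ∀ a, ∃ γ : C(I, E), γ 0 = c a ∧ ∀ u, p (γ u) = F (u, a)) :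
    ∃ g : I × A → E, Continuous g ∧ (∀ a, g (0, a) = c a) ∧ ∀ z, p (g z) = F z := by
  choose γ h0 hγ using h
  refine ⟨fun z => γ z.2 z.1, ?_, fun a => h0 a, fun z => hγ _ _⟩
  refine hp.continuous_lift (T2Space.isSeparatedMap p) F ?_ ?_ ?_
  · ext z; exact hγ _ _
  · simpa [h0] using hc
  · intro a; exact (γ a).continuous

theorem lift_unique (hp : IsLocalHomeomorph p) [PreconnectedSpace A] {g₁ g₂ : A → E}
    (h₁ : Continuous g₁) (h₂ : Continuous g₂) (he : ∀ a, p (g₁ a) = p (g₂ a)) (a : A)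
    (ha : g₁ a = g₂ a) (b : A) : g₁ b = g₂ b :=
  congrFun ((T2Space.isSeparatedMap p).eq_of_comp_eq hp.isLocallyInjective h₁ h₂ (funext he) a ha) b

theorem lift_ext [T2Space X] (hp : IsLocalHomeomorph p) (P : C(I, X)) (x₀ : E) (h0 : p x₀ = P 0)
    (K : Set E) (hK : IsCompact K)
    (hb : ∀ u : I, u < 1 → ∀ γ : C(I, E), γ 0 = x₀ → (∀ v, p (γ v) = P (u * v)) → γ 1 ∈ K) :
    ∃ γ : C(I, E), γ 0 = x₀ ∧ ∀ v, p (γ v) = P v := by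
  classical
  let F : C(I × I, X) := ⟨fun z => P (z.2 * z.1), by fun_prop⟩
  let T : Set I := {a | ∃ γ : C(I, E), γ 0 = x₀ ∧ ∀ u, p (γ u) = F (u, a)}
  have hTo : IsOpen T := lift_open hp F (fun _ => x₀) continuous_const (by simpa [F] using h0)
  have hT0 : (0 : I) ∈ T := ⟨ContinuousMap.const _ x₀, by simp, by simp [F, h0]⟩
  have hTd : ∀ a ∈ T, ∀ b ≤ a, b ∈ T := by
    rintro a ⟨γ, h1, h2⟩ b hba
    by_cases ha : (a : ℝ) = 0
    · have : b = 0 := by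
        apply Subtype.ext
        have := b.2.1
        have hba' : (b : ℝ) ≤ a := hba
        show (b : ℝ) = 0
        linarith
      rw [this]; exact hT0
    · have hap : (0 : ℝ) < a := lt_of_le_of_ne a.2.1 (Ne.symm ha)
      have hba' : (b : ℝ) ≤ a := hba
      let k : I := ⟨b / a, div_nonneg b.2.1 hap.le, (div_le_one hap).2 hba'⟩
      refine ⟨⟨fun v => γ (k * v), by fun_prop⟩, by simpa using h1, fun u => ?_⟩
      simp only [ContinuousMap.coe_mk, h2, F]
      congr 1
      apply Subtype.ext
      simp [k]; field_simp
  have hTc : IsClosed T := by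
    rw [← closure_subset_iff_isClosed]
    intro u hu
    by_contra huT
    have hlt : ∀ a ∈ T, a < u := fun a ha => not_le.1 fun h => huT (hTd a ha u h)
    let c : T → E := fun _ => x₀
    let F' : C(I × T, X) := ⟨fun z => F (z.1, z.2.1), by fun_prop⟩
    obtain ⟨g, hg, hg0, hgp⟩ := lift_cont hp F' c continuous_const (fun a => a.2)
    have : NeBot (𝓝[T] u) := mem_closure_iff_nhdsWithin_neBot.1 hu
    let e : I → E := fun a => if h : a ∈ T then g (1, ⟨a, h⟩) else x₀
    have heK : ∀ a ∈ T, e a ∈ K := by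
      intro a ha
      have := hb a (lt_of_lt_of_le (hlt a ha) u.2.2) ⟨fun v => g (v, ⟨a, ha⟩), by fun_prop⟩
        (hg0 _) (fun v => hgp _)
      simpa [e, ha] using this
    have hep : ∀ a ∈ T, p (e a) = P a := by
      intro a ha
      simp only [e, ha, dif_pos, hgp]
      simp [F', F]
    obtain ⟨k, hkK, hk⟩ := hK (f := map e (𝓝[T] u)) (by
      rw [le_principal_iff, mem_map]
      exact mem_of_superset self_mem_nhdsWithin heK)
    have hk' : MapClusterPt k (𝓝[T] u) e := hk
    have hpk : p k = P u := by
      have h1 : MapClusterPt (p k) (𝓝[T] u) (p ∘ e) := hk'.continuousAt_comp hp.continuous.continuousAt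
      have h2 : Tendsto (p ∘ e) (𝓝[T] u) (𝓝 (P u)) := by
        have : Tendsto P (𝓝[T] u) (𝓝 (P u)) := P.continuous.continuousAt.continuousWithinAt
        refine this.congr' ?_
        filter_upwards [self_mem_nhdsWithin] with a ha
        exact (hep a ha).symm
      have h3 : ClusterPt (p k) (𝓝 (P u)) := ClusterPt.mono h1 h2
      exact eq_of_nhds_neBot h3
    obtain ⟨φ, hkφ, rfl⟩ := hp k
    have htar : ∀ᶠ a in 𝓝 u, P a ∈ φ.target := by
      refine P.continuous.continuousAt.eventually_mem (φ.open_target.mem_nhds ?_)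
      rw [← hpk]; exact φ.map_source hkφ
    have hcon : ∃ l < u, ∀ a, l < a → a ≤ u → P a ∈ φ.target := by
      have h0u : (0 : I) < u := hlt 0 hT0
      obtain ⟨l, hl, hl2⟩ := exists_Ioc_subset_of_mem_nhds htar ⟨0, h0u⟩
      exact ⟨l, hl, fun a h1 h2 => hl2 ⟨h1, h2⟩⟩
    obtain ⟨l, hlu, hl⟩ := hcon
    have hfr : ∃ᶠ a in 𝓝[T] u, e a ∈ φ.source :=
      mapClusterPt_iff_frequently.1 hk' _ (φ.open_source.mem_nhds hkφ)
    obtain ⟨v, hv, hvT, hlv⟩ := (hfr.and_eventually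
      ((eventually_mem_nhdsWithin).and (mem_nhdsWithin_of_mem_nhds (isOpen_Ioi.mem_nhds hlu)))).exists
    have hlv : l < v := hlv
    have hvu : v < u := hlt v hvT
    have hvpos : (0 : ℝ) < v := lt_of_le_of_lt l.2.1 hlv
    have hev : e v = φ.symm (P v) := by
      rw [← hep v hvT, φ.left_inv hv]
    apply huT
    let γ₁ : I → E := fun x => g (projIcc 0 1 zero_le_one ((u : ℝ) * x / v), ⟨v, hvT⟩)
    let γ₂ : I → E := fun x => φ.symm (P (max (u * x) v))
    have hm : ∀ x : I, P (max (u * x) v) ∈ φ.target := fun x =>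
      hl _ (lt_of_lt_of_le hlv (le_max_right _ _)) (max_le unitInterval.mul_le_left hvu.le)
    have hγ : Continuous (fun x : I => if u * x ≤ v then γ₁ x else γ₂ x) := by
      refine Continuous.if_le ?_ ?_ (by fun_prop) continuous_const ?_
      · refine hg.comp (Continuous.prodMk (continuous_projIcc.comp ?_) continuous_const)
        fun_prop
      · exact φ.continuousOn_symm.comp_continuous (by fun_prop) hm
      · intro x hx
        have h1 : ((u : ℝ) * x / v) = 1 := by
          have : (u : ℝ) * x = v := by rw [← hx]; simp
          rw [this]; field_simp
        simp only [γ₁, γ₂, h1, hx, max_self, ← hev]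
        simp [e, hvT]
    refine ⟨⟨_, hγ⟩, ?_, ?_⟩
    · simp [γ₁, hg0, c]
    · intro x
      by_cases hx : u * x ≤ v
      · simp only [ContinuousMap.coe_mk, hx, if_true, γ₁, hgp, F', F]
        congr 1
        have h3 : ((u : ℝ) * x / v) ∈ Icc (0 : ℝ) 1 := ⟨by have := u.2.1; have := x.2.1; positivity, (div_le_one hvpos).2 (by exact_mod_cast hx)⟩
        apply Subtype.ext
        rw [projIcc_of_mem _ h3]
        simp; field_simp
      · simp only [ContinuousMap.coe_mk, hx, if_false, γ₂, F]
        rw [φ.right_inv (hm x), max_eq_left (not_le.1 hx).le]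
  have := IsClopen.eq_univ ⟨hTc, hTo⟩ ⟨0, hT0⟩
  obtain ⟨γ, h1, h2⟩ : (1 : I) ∈ T := this ▸ mem_univ _
  exact ⟨γ, h1, by simpa [F] using h2⟩

end lifting

section partone
variable {E H : Type*} [NormedAddCommGroup E] [NormedSpace ℝ E] [FiniteDimensional ℝ E]
    [NormedAddCommGroup H] [InnerProductSpace ℝ H] {f : E → H} {f' : E → E →L[ℝ] H}

theorem lower_bd {L : E →L[ℝ] H} {x : E} (h : HasFDerivAt f L x) (hi : Injective L) :
    ∃ m : ℕ, 0 < m ∧ ∀ y, dist y x < 1 / (m : ℝ) → dist y x ≤ m * dist (f y) (f x) := by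
  obtain ⟨K, -, hK⟩ := L.toLinearMap.exists_antilipschitzWith (LinearMap.ker_eq_bot.2 hi)
  obtain ⟨c, hc⟩ := (h.isTheta_sub (hK.isInducing L.continuous)).2.bound
  obtain ⟨r, hr, hr2⟩ := Metric.eventually_nhds_iff.1 hc
  obtain ⟨m, hm⟩ := exists_nat_gt (max c (1 / r))
  have h1 : c < m := lt_of_le_of_lt (le_max_left _ _) hm
  have h2 : 1 / r < m := lt_of_le_of_lt (le_max_right _ _) hm
  have hm0 : (0 : ℝ) < m := lt_trans (by positivity) h2
  refine ⟨m, by exact_mod_cast hm0, fun y hy => ?_⟩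
  have h3 : 1 / (m : ℝ) < r := by
    rw [div_lt_iff₀ hm0]; rw [div_lt_iff₀ hr] at h2; linarith
  have := hr2 (hy.trans h3)
  rw [dist_eq_norm, dist_eq_norm]
  exact this.trans (by gcongr)

theorem open_at {U : Set E} (hU : IsOpen U) (hf : ∀ x ∈ U, HasFDerivAt f (f' x) x)
    (hi : ∀ x ∈ U, Bijective (f' x)) (x : E) (hx : x ∈ U) (N : Set E) (hN : N ∈ 𝓝 x) :
    f '' N ∈ 𝓝 (f x) := by
  have : ProperSpace E := FiniteDimensional.proper ℝ E
  obtain ⟨m, hm, hlb⟩ := lower_bd (hf x hx) (hi x hx).1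
  have hm' : (0 : ℝ) < m := by exact_mod_cast hm
  have : N ∩ U ∩ ball x (1 / m) ∈ 𝓝 x :=
    inter_mem (inter_mem hN (hU.mem_nhds hx)) (ball_mem_nhds _ (by positivity))
  obtain ⟨r, hr, hr2⟩ := nhds_basis_closedBall.mem_iff.1 this
  refine mem_of_superset (ball_mem_nhds (f x) (show 0 < r / (2 * m) by positivity)) ?_
  intro w hw
  rw [mem_ball, dist_comm] at hw
  obtain ⟨y, hy, rfl⟩ := min_lemma (g := f) (g' := f') (x := x) (r := r) (w := w) hr
    (fun y hy => hf y (hr2 hy).1.2) (fun y hy => (hi y (hr2 hy).1.2).2) (by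
      intro y hy
      have h1 := hlb y (hr2 (sphere_subset_closedBall hy)).2
      rw [mem_sphere.1 hy] at h1
      rw [← dist_eq_norm, ← dist_eq_norm]
      have h2 : r / m ≤ dist (f y) (f x) := by rw [div_le_iff₀ hm']; linarith
      have h3 := dist_triangle (f y) w (f x)
      rw [dist_comm w (f x)] at h3
      have h4 : r / m = 2 * (r / (2 * m)) := by field_simp
      linarith)
  exact ⟨y, (hr2 (ball_subset_closedBall hy)).1.1, rfl⟩

theorem mk_homeo {E H : Type*} [TopologicalSpace E] [TopologicalSpace H] {f : E → H} {U : Set E} (hU : IsOpen U) (hc : ContinuousOn f U)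
    (ho : ∀ x ∈ U, ∀ N ∈ 𝓝 x, f '' N ∈ 𝓝 (f x)) (hl : ∀ x ∈ U, ∃ N ∈ 𝓝 x, InjOn f N) :
    IsLocalHomeomorph (fun x : U => f x) := by
  have hc' : Continuous (fun x : U => f x) := continuousOn_iff_continuous_domRestrict.1 hc
  have ho' : IsOpenMap (fun x : U => f x) := by
    rw [isOpenMap_iff_nhds_le]
    rintro ⟨x, hx⟩ s hs
    rw [mem_map] at hs
    rw [nhds_subtype_eq_comap, mem_comap] at hs
    obtain ⟨t, ht, hts⟩ := hs
    refine mem_of_superset (ho x hx (t ∩ U) (inter_mem ht (hU.mem_nhds hx))) ?_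
    rintro _ ⟨y, ⟨hyt, hyU⟩, rfl⟩
    exact hts (show (⟨y, hyU⟩ : U) ∈ Subtype.val ⁻¹' t from hyt)
  rw [isLocalHomeomorph_iff_isOpenEmbedding_restrict]
  rintro ⟨x, hx⟩
  obtain ⟨N, hN, hinj⟩ := hl x hx
  have hW : IsOpen (Subtype.val ⁻¹' interior N : Set U) := isOpen_interior.preimage continuous_subtype_val
  refine ⟨Subtype.val ⁻¹' interior N, hW.mem_nhds (mem_interior_iff_mem_nhds.2 hN), ?_⟩
  refine .of_continuous_injective_isOpenMap (hc'.comp continuous_subtype_val) ?_ (ho'.domRestrict hW)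
  rintro ⟨⟨a, ha⟩, haN⟩ ⟨⟨b, hb⟩, hbN⟩ hab
  have := hinj (interior_subset haN) (interior_subset hbN) hab
  subst this; rfl

theorem loc_inj {U : Set E} (hU : IsOpen U) (hf : ∀ x ∈ U, HasFDerivAt f (f' x) x)
    (hi : ∀ x ∈ U, Bijective (f' x)) : ∀ x ∈ U, ∃ N ∈ 𝓝 x, InjOn f N := by
  have : ProperSpace E := FiniteDimensional.proper ℝ E
  have hcont : ContinuousOn f U := fun x hx => (hf x hx).continuousAt.continuousWithinAt
  let W : Set E := {x | ∃ N ∈ 𝓝 x, InjOn f N}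
  have hW : IsOpen W := by
    rw [isOpen_iff_mem_nhds]
    rintro x ⟨N, hN, hinj⟩
    filter_upwards [interior_mem_nhds.2 hN] with y hy
    exact ⟨N, mem_interior_iff_mem_nhds.1 hy, hinj⟩
  by_contra! hcon
  obtain ⟨x₀, hx₀, hx₀'⟩ := hcon
  let S : Set E := U \ W
  have hxS : x₀ ∈ S := ⟨hx₀, fun ⟨N, hN, h⟩ => hx₀' N hN h⟩
  have hSlc : IsLocallyClosed S := hU.isLocallyClosed.inter hW.isClosed_compl.isLocallyClosed
  have : LocallyCompactSpace S := hSlc.locallyCompactSpace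
  have : Nonempty S := ⟨⟨x₀, hxS⟩⟩
  have hfS : Continuous (fun z : S => f z) :=
    continuousOn_iff_continuous_domRestrict.1 (hcont.mono sdiff_subset)
  let T : ℕ → Set S := fun m => {z | ∀ z', dist z' (z : E) < 1 / ((m : ℝ) + 1) →
    dist z' (z : E) ≤ (m + 1) * dist (f z') (f z)}
  have hTc : ∀ m, IsClosed (T m) := by
    intro m
    have : T m = ⋂ z', ({z : S | 1 / ((m : ℝ) + 1) ≤ dist z' (z : E)} ∪
        {z : S | dist z' (z : E) ≤ (m + 1) * dist (f z') (f z)}) := by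
      ext z
      simp only [T, mem_ofPred_eq, mem_iInter, mem_union, ← not_lt, imp_iff_not_or]
    rw [this]
    refine isClosed_iInter fun z' => IsClosed.union ?_ ?_
    · exact isClosed_le continuous_const (by fun_prop)
    · exact isClosed_le (by fun_prop) (continuous_const.mul (continuous_const.dist hfS))
  have hTu : ⋃ m, T m = univ := by
    rw [eq_univ_iff_forall]
    rintro ⟨z, hz⟩
    obtain ⟨m, hm, h⟩ := lower_bd (hf z hz.1) (hi z hz.1).1
    rw [mem_iUnion]
    refine ⟨m - 1, ?_⟩
    have : (((m - 1 : ℕ) : ℝ) + 1) = m := by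
      have : m - 1 + 1 = m := Nat.succ_pred_eq_of_pos hm
      exact_mod_cast this
    simp only [T, mem_ofPred_eq, this]
    exact h
  obtain ⟨m₀, ⟨⟨p, hpS⟩, hp⟩⟩ := nonempty_interior_of_iUnion_of_closed hTc hTu
  obtain ⟨m, hm⟩ : ∃ m : ℝ, m = m₀ + 1 := ⟨_, rfl⟩
  have hm1 : 1 ≤ m := by rw [hm]; have := m₀.cast_nonneg (α := ℝ); linarith
  have hm0 : 0 < m := by linarith
  obtain ⟨δ, hδ, hδ2⟩ := Metric.mem_nhds_iff.1 (mem_interior_iff_mem_nhds.1 hp)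
  have hTp : ∀ z ∈ S, dist z p < δ → ∀ z', dist z' z < 1 / m → dist z' z ≤ m * dist (f z') (f z) := by
    intro z hz hzp
    have : (⟨z, hz⟩ : S) ∈ T m₀ := hδ2 (by simpa [Subtype.dist_eq] using hzp)
    rw [hm]; exact this
  obtain ⟨r, hr, hrU, hrδ, hrm⟩ : ∃ r > 0, closedBall p r ⊆ U ∧ r < δ ∧ 2 * r < 1 / m := by
    obtain ⟨r₁, h1, h2⟩ := nhds_basis_closedBall.mem_iff.1 (hU.mem_nhds hpS.1)
    have h3 : 0 < 1 / m := by positivity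
    refine ⟨min r₁ (min (δ / 2) (1 / m / 4)), by positivity, (closedBall_subset_closedBall (min_le_left _ _)).trans h2, ?_, ?_⟩
    · have : min r₁ (min (δ / 2) (1 / m / 4)) ≤ δ / 2 := (min_le_right _ _).trans (min_le_left _ _)
      linarith
    · have : min r₁ (min (δ / 2) (1 / m / 4)) ≤ 1 / m / 4 := (min_le_right _ _).trans (min_le_right _ _)
      linarith
  have key : ∀ z ∈ S, z ∈ closedBall p r → ∀ z' ∈ closedBall p r, dist z' z ≤ m * dist (f z') (f z) := by
    intro z hz hzp z' hz'
    rw [mem_closedBall] at hzp hz'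
    refine hTp z hz (by linarith) z' ?_
    have := dist_triangle_right z' z p
    linarith
  have hsph : ∀ y ∈ closedBall p r, y ∉ ball p r → r ≤ m * dist (f y) (f p) := by
    intro y hy hy'
    have h1 := key p hpS (mem_closedBall_self hr.le) y hy
    rw [mem_ball] at hy'
    linarith
  obtain ⟨ρ, hρ, hρr⟩ : ∃ ρ > 0, m * (2 * ρ) < r := ⟨r / (4 * m), by positivity, by
    have : m * (2 * (r / (4 * m))) = r / 2 := by field_simp; norm_num
    rw [this]; linarith⟩
  have hcB : ContinuousOn f (closedBall p r) := hcont.mono hrU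
  have hcb : ContinuousOn f (ball p r) := hcB.mono ball_subset_closedBall
  have hX : ball p r ∩ f ⁻¹' ball (f p) ρ ∈ 𝓝 p := inter_mem (ball_mem_nhds p hr)
    ((hf p hpS.1).continuousAt.preimage_mem_nhds (ball_mem_nhds _ hρ))
  have hnX : ¬ InjOn f (ball p r ∩ f ⁻¹' ball (f p) ρ) := fun h => hpS.2 ⟨_, hX, h⟩
  simp only [InjOn, not_forall] at hnX
  obtain ⟨z', hz', z'', hz'', hzz, hne⟩ := hnX
  obtain ⟨w, hw⟩ : ∃ w, w = f z' := ⟨_, rfl⟩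
  have hw2 : f z'' = w := by rw [hw, hzz]
  have hwρ : dist w (f p) < ρ := by rw [hw]; exact hz'.2
  have hScomp : IsCompact (S ∩ closedBall p r) := by
    have : S ∩ closedBall p r = closedBall p r \ W := by
      ext z; constructor
      · rintro ⟨h1, h2⟩; exact ⟨h2, h1.2⟩
      · rintro ⟨h1, h2⟩; exact ⟨⟨hrU h1, h2⟩, h1⟩
    rw [this]; exact (isCompact_closedBall p r).diff hW
  have hCc : IsCompact (f '' (S ∩ closedBall p r)) := hScomp.image_of_continuousOn (hcB.mono inter_subset_right)
  have hpC : f p ∈ f '' (S ∩ closedBall p r) := ⟨p, ⟨hpS, mem_closedBall_self hr.le⟩, rfl⟩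
  obtain ⟨_, ⟨z₁, ⟨hz₁S, hz₁B⟩, rfl⟩, hd⟩ := hCc.exists_infDist_eq_dist ⟨_, hpC⟩ w
  obtain ⟨d, hdd⟩ : ∃ d, d = dist w (f z₁) := ⟨_, rfl⟩
  have hdle : ∀ z ∈ S, z ∈ closedBall p r → d ≤ dist w (f z) := by
    intro z hz hzB
    rw [hdd, ← hd]; exact infDist_le_dist_of_mem ⟨z, ⟨hz, hzB⟩, rfl⟩
  have hd0 : 0 < d := by
    rw [hdd, dist_pos]
    intro h
    have h1 := key z₁ hz₁S hz₁B z' (ball_subset_closedBall hz'.1)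
    have h2 := key z₁ hz₁S hz₁B z'' (ball_subset_closedBall hz''.1)
    rw [hw2, h, dist_self, mul_zero] at h2
    rw [← hw, h, dist_self, mul_zero] at h1
    exact hne ((dist_le_zero.1 h1).trans (dist_le_zero.1 h2).symm)
  have hdρ : d < ρ := (hdle p hpS (mem_closedBall_self hr.le)).trans_lt hwρ
  have hinb : ∀ z ∈ closedBall p r, dist (f z) w ≤ d → z ∈ ball p r := by
    intro z hz hzd
    by_contra hzb
    have h1 := hsph z hz hzb
    have h2 := dist_triangle (f z) w (f p)
    have h3 : m * dist (f z) (f p) ≤ m * (2 * ρ) := by gcongr; linarith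
    linarith
  have hz₁b : z₁ ∈ ball p r := hinb z₁ hz₁B (by rw [hdd, dist_comm])
  let Y : Set E := ball p r ∩ f ⁻¹' ball w d
  have hYo : IsOpen Y := hcb.isOpen_inter_preimage isOpen_ball isOpen_ball
  have hYU : Y ⊆ U := fun z hz => hrU (ball_subset_closedBall hz.1)
  have hYh : IsLocalHomeomorph (fun x : Y => f x) := by
    refine mk_homeo hYo (hcont.mono hYU) (fun x hx => open_at hU hf hi x (hYU hx)) ?_
    intro x hx
    by_contra h
    have h1 := hdle x ⟨hYU hx, h⟩ (ball_subset_closedBall hx.1)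
    have h2 : dist (f x) w < d := hx.2
    rw [dist_comm] at h2; linarith
  have hwd : w ∈ ball w d := mem_ball_self hd0
  have sect : ∀ z₀ ∈ Y, f z₀ = w → ∃ g : ball w d → Y, Continuous g ∧ (∀ v, f (g v) = v) ∧
      (g ⟨w, hwd⟩ : E) = z₀ := by
    intro z₀ hz₀ hfz
    let F : C(unitInterval × ball w d, H) := ⟨fun z => w + (z.1 : ℝ) • ((z.2 : H) - w), by fun_prop⟩
    have hex : ∀ v : ball w d, ∃ γ : C(unitInterval, Y), γ 0 = (⟨z₀, hz₀⟩ : Y) ∧ ∀ u, f (γ u) = F (u, v) := by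
      rintro ⟨v, hv⟩
      let P : C(unitInterval, H) := ⟨fun u => w + (u : ℝ) • (v - w), by fun_prop⟩
      have hKc : IsCompact (closedBall p r ∩ f ⁻¹' closedBall w (dist v w)) :=
        (isCompact_closedBall p r).of_isClosed_subset
          (hcB.preimage_isClosed_of_isClosed isClosed_closedBall isClosed_closedBall) inter_subset_left
      have hKY : closedBall p r ∩ f ⁻¹' closedBall w (dist v w) ⊆ Y := by
        rintro z ⟨h1, h2⟩
        have h3 : dist (f z) w ≤ dist v w := h2
        have h4 : dist v w < d := hv
        exact ⟨hinb z h1 (by linarith), by rw [mem_preimage, mem_ball]; linarith⟩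
      refine lift_ext hYh P ⟨z₀, hz₀⟩ (by simp [P, hfz]) (Subtype.val ⁻¹' (closedBall p r ∩ f ⁻¹' closedBall w (dist v w))) ?_ ?_
      · refine IsEmbedding.subtypeVal.isInducing.isCompact_preimage_iff ?_ |>.2 hKc
        rwa [Subtype.range_coe]
      · intro u hu γ hγ0 hγ
        refine ⟨ball_subset_closedBall (γ 1).2.1, ?_⟩
        have h5 := hγ 1
        rw [mem_preimage, mem_closedBall, h5]
        simp only [P, ContinuousMap.coe_mk, mul_one]
        rw [dist_eq_norm, add_sub_cancel_left, norm_smul, dist_eq_norm]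
        have h6 : ‖(u : ℝ)‖ ≤ 1 := by rw [Real.norm_eq_abs, abs_of_nonneg u.2.1]; exact u.2.2
        exact mul_le_of_le_one_left (norm_nonneg _) h6
    obtain ⟨g, hg, hg0, hgp⟩ := lift_cont hYh F (fun _ => ⟨z₀, hz₀⟩) continuous_const hex
    refine ⟨fun v => g (1, v), by fun_prop, fun v => ?_, ?_⟩
    · simp only [hgp]; simp [F]
    · have := lift_unique hYh (g₁ := fun u : unitInterval => g (u, ⟨w, hwd⟩)) (g₂ := fun _ => ⟨z₀, hz₀⟩)
        (by fun_prop) continuous_const (fun u => by simp only [hgp]; simp [F, hfz]) 0 (hg0 _) 1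
      exact congrArg Subtype.val this
  obtain ⟨g', hg'c, hg'f, hg'w⟩ := sect z' ⟨hz'.1, by rw [mem_preimage, ← hw]; exact hwd⟩ hw.symm
  obtain ⟨g'', hg''c, hg''f, hg''w⟩ := sect z'' ⟨hz''.1, by rw [mem_preimage, hw2]; exact hwd⟩ hw2
  -- derivative estimate
  obtain ⟨δ₁, hδ₁, hδ₁b, hδ₁e⟩ : ∃ δ₁ > 0, ball z₁ δ₁ ⊆ ball p r ∧ ∀ y ∈ ball z₁ δ₁,
      ‖f y - f z₁ - f' z₁ (y - z₁)‖ ≤ 1 / (4 * m) * ‖y - z₁‖ := by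
    have h1 := (hf z₁ hz₁S.1).isLittleO.bound (show 0 < 1 / (4 * m) by positivity)
    obtain ⟨δ₁, h2, h3⟩ := Metric.mem_nhds_iff.1 (inter_mem h1 (isOpen_ball.mem_nhds hz₁b))
    exact ⟨δ₁, h2, fun y hy => (h3 hy).2, fun y hy => (h3 hy).1⟩
  obtain ⟨l, hl0, hl1, hlδ⟩ : ∃ l > 0, l ≤ 1 ∧ m * (l * d) < δ₁ := by
    have h9 : 0 < m * d := by positivity
    refine ⟨min 1 (δ₁ / (2 * (m * d))), by positivity, min_le_left _ _, ?_⟩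
    have : min 1 (δ₁ / (2 * (m * d))) ≤ δ₁ / (2 * (m * d)) := min_le_right _ _
    calc m * (min 1 (δ₁ / (2 * (m * d))) * d) = min 1 (δ₁ / (2 * (m * d))) * (m * d) := by ring
      _ ≤ δ₁ / (2 * (m * d)) * (m * d) := by gcongr
      _ = δ₁ / 2 := by field_simp
      _ < δ₁ := by linarith
  obtain ⟨c, hc⟩ : ∃ c, c = l • (w - f z₁) := ⟨_, rfl⟩
  have hcn : ‖c‖ = l * d := by
    rw [hc, norm_smul, Real.norm_eq_abs, abs_of_pos hl0, hdd, dist_eq_norm]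
  have hcw : dist (f z₁ + c) w = (1 - l) * d := by
    have : f z₁ + c - w = (1 - l) • (f z₁ - w) := by rw [hc]; module
    rw [dist_eq_norm, this, norm_smul, Real.norm_eq_abs, abs_of_nonneg (by linarith), hdd, dist_comm, dist_eq_norm]
  have hld : 0 < l * d := by positivity
  have hcV : f z₁ + c ∈ ball w d := by rw [mem_ball, hcw]; nlinarith
  have near : ∀ a ∈ Y, f a = f z₁ + c → a ∈ closedBall z₁ (m * (l * d)) ∧
      f' z₁ (a - z₁) ∈ closedBall c (1 / 4 * (l * d)) := by
    intro a ha hfa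
    have h1 := key z₁ hz₁S hz₁B a (ball_subset_closedBall ha.1)
    rw [hfa, dist_eq_norm (f z₁ + c), add_sub_cancel_left, hcn] at h1
    refine ⟨h1, ?_⟩
    have h2 := hδ₁e a (lt_of_le_of_lt h1 hlδ)
    rw [hfa, add_sub_cancel_left] at h2
    rw [mem_closedBall, dist_comm, dist_eq_norm]
    refine h2.trans ?_
    rw [← dist_eq_norm]
    calc 1 / (4 * m) * dist a z₁ ≤ 1 / (4 * m) * (m * (l * d)) := by gcongr
      _ = 1 / 4 * (l * d) := by field_simp
  have ha := near (g' ⟨_, hcV⟩) (g' ⟨_, hcV⟩).2 (hg'f _)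
  have hb := near (g'' ⟨_, hcV⟩) (g'' ⟨_, hcV⟩).2 (hg''f _)
  have hseg : ∀ s : unitInterval, AffineMap.lineMap (g' ⟨_, hcV⟩ : E) (g'' ⟨_, hcV⟩ : E) (s : ℝ) ∈ Y := by
    intro s
    obtain ⟨y, hy⟩ : ∃ y, y = AffineMap.lineMap (g' ⟨_, hcV⟩ : E) (g'' ⟨_, hcV⟩ : E) (s : ℝ) := ⟨_, rfl⟩
    rw [← hy]
    have h1 : y ∈ closedBall z₁ (m * (l * d)) := by
      rw [hy]; exact (convex_closedBall _ _).lineMap_mem ha.1 hb.1 s.2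
    have h2 : f' z₁ (y - z₁) ∈ closedBall c (1 / 4 * (l * d)) := by
      have h3 := (convex_closedBall c (1 / 4 * (l * d))).lineMap_mem ha.2 hb.2 s.2
      convert h3 using 1
      rw [hy, AffineMap.lineMap_apply_module, AffineMap.lineMap_apply_module, ← map_smul, ← map_smul, ← map_add]
      congr 1; module
    have h1' : y ∈ ball z₁ δ₁ := lt_of_le_of_lt h1 hlδ
    have h4 := hδ₁e y h1'
    refine ⟨hδ₁b h1', ?_⟩
    have h5 : ‖f y - f z₁ - f' z₁ (y - z₁)‖ ≤ 1 / 4 * (l * d) := by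
      refine h4.trans ?_
      rw [← dist_eq_norm]
      rw [mem_closedBall] at h1
      calc 1 / (4 * m) * dist y z₁ ≤ 1 / (4 * m) * (m * (l * d)) := by gcongr
        _ = 1 / 4 * (l * d) := by field_simp
    rw [mem_closedBall, dist_eq_norm] at h2
    have h6 : dist (f y) (f z₁ + c) ≤ 1 / 2 * (l * d) := by
      rw [dist_eq_norm]
      have : f y - (f z₁ + c) = (f y - f z₁ - f' z₁ (y - z₁)) + (f' z₁ (y - z₁) - c) := by abel
      rw [this]
      refine (norm_add_le _ _).trans ?_
      linarith
    have h7 := dist_triangle (f y) (f z₁ + c) w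
    rw [mem_preimage, mem_ball]
    rw [hcw] at h7
    linarith
  have e1 := lift_unique hYh (g₁ := fun s : unitInterval => (⟨_, hseg s⟩ : Y))
    (g₂ := fun s : unitInterval => g' ⟨f (AffineMap.lineMap (g' ⟨_, hcV⟩ : E) (g'' ⟨_, hcV⟩ : E) (s : ℝ)), (hseg s).2⟩)
    (by
      refine Continuous.subtype_mk ?_ _
      exact AffineMap.lineMap_continuous.comp continuous_subtype_val)
    (by
      refine hg'c.comp (Continuous.subtype_mk ?_ _)
      exact hcb.comp_continuous (AffineMap.lineMap_continuous.comp continuous_subtype_val) (fun s => (hseg s).1))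
    (fun s => by simp only [hg'f]) 0
    (by
      apply Subtype.ext
      simp [hg'f]) 1
  have e2 : g'' ⟨_, hcV⟩ = g' ⟨_, hcV⟩ := by
    have := congrArg Subtype.val e1
    simp only [Set.Icc.coe_one, AffineMap.lineMap_apply_one, hg''f] at this
    exact Subtype.ext this
  have : PreconnectedSpace (ball w d) := Subtype.preconnectedSpace (convex_ball w d).isPreconnected
  have e3 := lift_unique hYh hg''c hg'c (fun v => by simp only [hg'f, hg''f]) ⟨_, hcV⟩ e2 ⟨w, hwd⟩
  exact hne (by rw [← hg'w, ← hg''w, e3])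

theorem local_homeo {U : Set E} (hU : IsOpen U) (hf : ∀ x ∈ U, HasFDerivAt f (f' x) x)
    (hi : ∀ x ∈ U, Bijective (f' x)) : IsLocalHomeomorph (fun x : U => f x) :=
  mk_homeo hU (fun x hx => (hf x hx).continuousAt.continuousWithinAt) (open_at hU hf hi)
    (loc_inj hU hf hi)

end partone

def hfun (t₀ N s τ t : ℝ) : ℝ := 1 - s + s ^ 2 / 8 + (τ - 1 / 2) ^ 2 - N * (t - t₀) ^ 2

abbrev PA (t₀ δ : ℝ) : Type := Icc (0 : ℝ) 2 × unitInterval × Icc (t₀ - δ) (t₀ + δ)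

section core
open unitInterval

variable {V : Type*} [NormedAddCommGroup V] [NormedSpace ℝ V] [ProperSpace V]

theorem core {ε : ℝ} {U : Set (V × ℝ)} (hU : U = {x : V × ℝ | x.2 ∈ Ioo 0 ε}) {f : V → V} {φ : U → V × ℝ}
    (hφ : IsLocalHomeomorph φ)
    (hφf : ∀ x : U, φ x = (f x.1.1 - x.1.2 • x.1.1, x.1.2))
    {w e n : V} (α β : V → ℝ) (hz : ∀ z, z = α z • e + β z • n)
    {t₀ δ : ℝ} (hδ : 0 < δ) (hJ : Icc (t₀ - δ) (t₀ + δ) ⊆ Ioo 0 ε)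
    (g : I × Icc (t₀ - δ) (t₀ + δ) → U) (hg : Continuous g)
    (hgφ : ∀ a, φ (g a) = (w + (a.1 : ℝ) • e, (a.2 : ℝ)))
    (hface : ∀ (s : Icc (0 : ℝ) 2) (τ : I) (t : Icc (t₀ - δ) (t₀ + δ)), (τ = 0 ∨ τ = 1) →
      ∃ γ : C(I, U), γ 0 = g (τ, t) ∧ ∀ u : I, φ (γ u) = (w + (τ : ℝ) • e + ((u : ℝ) * s) • n, (t : ℝ)))
    (ht₀ : t₀ ∈ Icc (t₀ - δ) (t₀ + δ)) :
    ∃ δ' γ : C(I, U), δ' 0 = g (0, ⟨t₀, ht₀⟩) ∧ γ 0 = g (1, ⟨t₀, ht₀⟩) ∧ γ 1 = δ' 1 ∧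
      (∀ u : I, φ (δ' u) = (w + (u : ℝ) • (e + n), t₀)) ∧
      (∀ u : I, φ (γ u) = (w + e + (u : ℝ) • n, t₀)) := by
  classical
  let F : C(I × (PA t₀ δ), V × ℝ) := ⟨fun z => (w + (z.2.2.1 : ℝ) • e + ((z.1 : ℝ) * z.2.1) • n, (z.2.2.2 : ℝ)), by fun_prop⟩
  let Ag : Set (PA t₀ δ) := {a | ∃ γ : C(I, U), γ 0 = g a.2 ∧ ∀ u, φ (γ u) = F (u, a)}
  have hAgo : IsOpen Ag := lift_open hφ F (fun a => g a.2) (by fun_prop) (fun a => by rw [hgφ]; simp [F])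
  let F' : C(I × Ag, V × ℝ) := ⟨fun z => F (z.1, z.2.1), by fun_prop⟩
  obtain ⟨G, hGc, hG0, hGφ⟩ := lift_cont hφ F' (fun a : Ag => g a.1.2) (by fun_prop) (fun a => a.2)
  have hs0 : ∀ a : PA t₀ δ, (a.1 : ℝ) = 0 → a ∈ Ag := by
    intro a ha
    refine ⟨ContinuousMap.const _ (g a.2), rfl, fun u => ?_⟩
    simp [F, hgφ, ha]
  let Face : Set (PA t₀ δ) := {a | (a.1 : ℝ) = 0 ∨ (a.2.1 : ℝ) = 0 ∨ (a.2.1 : ℝ) = 1}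
  have hFc : IsClosed Face := by
    refine IsClosed.union ?_ (IsClosed.union ?_ ?_)
    · exact isClosed_eq (by fun_prop) (by fun_prop)
    · exact isClosed_eq (by fun_prop) (by fun_prop)
    · exact isClosed_eq (by fun_prop) (by fun_prop)
  have hFA : Face ⊆ Ag := by
    rintro ⟨s, τ, t⟩ (h | h)
    · exact hs0 _ h
    · refine hface s τ t ?_
      rcases h with h | h
      · exact Or.inl (Subtype.ext h)
      · exact Or.inr (Subtype.ext h)
  obtain ⟨M₀, hM₀⟩ : ∃ M₀ : ℝ, ∀ a : Ag, a.1 ∈ Face → ‖(G (1, a)).1.1‖ ≤ M₀ := by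
    have hcomp : IsCompact (Subtype.val ⁻¹' Face : Set Ag) := by
      refine IsEmbedding.subtypeVal.isInducing.isCompact_preimage_iff ?_ |>.2 hFc.isCompact
      rwa [Subtype.range_coe]
    obtain ⟨M, hM⟩ := hcomp.exists_bound_of_continuousOn (f := fun a : Ag => (G (1, a)).1.1)
      (Continuous.continuousOn (by fun_prop))
    exact ⟨M, fun a ha => hM a ha⟩
  obtain ⟨N, hN⟩ : ∃ N, N = 2 / δ ^ 2 := ⟨_, rfl⟩
  have hNδ : N * δ ^ 2 = 2 := by rw [hN]; field_simp
  have hN0 : 0 < N := by rw [hN]; positivity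
  let h : PA t₀ δ → ℝ := fun a => hfun t₀ N a.1 a.2.1 a.2.2
  have hhc : Continuous h := by unfold h hfun; fun_prop
  -- propagation bound
  have bound : ∀ c, 0 ≤ c → (∀ a, c < h a → a ∈ Ag) → ∀ a : Ag, c < h a.1 →
      N ≤ β (G (1, a)).1.1 ^ 2 / 8 + α (G (1, a)).1.1 ^ 2 → ‖(G (1, a)).1.1‖ ≤ M₀ := by
    intro c hc hcA a ha hQ
    obtain ⟨⟨⟨s, hs⟩, ⟨τ, hτ⟩, ⟨t, ht⟩⟩, haA⟩ := a
    obtain ⟨z, hzdef⟩ : ∃ z, z = (G (1, ⟨⟨⟨s, hs⟩, ⟨τ, hτ⟩, ⟨t, ht⟩⟩, haA⟩)).1.1 := ⟨_, rfl⟩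
    rw [← hzdef] at hQ ⊢
    have hGa : φ (G (1, ⟨⟨⟨s, hs⟩, ⟨τ, hτ⟩, ⟨t, ht⟩⟩, haA⟩)) = (w + τ • e + s • n, t) := by
      rw [hGφ]; simp [F', F]
    have hGt : (G (1, ⟨⟨⟨s, hs⟩, ⟨τ, hτ⟩, ⟨t, ht⟩⟩, haA⟩)).1.2 = t := by
      have := hGa; rw [hφf] at this; exact congrArg Prod.snd this
    have hfz : f z - t • z = w + τ • e + s • n := by
      have := hGa; rw [hφf] at this
      have := congrArg Prod.fst this
      simp only [hGt] at this
      rw [← hzdef] at this; exact this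
    have hU' : ∀ t' ∈ (Icc (t₀ - δ) (t₀ + δ)), (z, t') ∈ U := fun t' h => by rw [hU]; exact hJ h
    obtain ⟨B, hB⟩ : ∃ B, B = β z - s * β z / 4 - 2 * α z * (τ - 1 / 2) - 2 * N * (t - t₀) := ⟨_, rfl⟩
    have hexp : ∀ r, hfun t₀ N (s - r * β z) (τ - r * α z) (t + r) =
        hfun t₀ N s τ t + r * B + r ^ 2 * (β z ^ 2 / 8 + α z ^ 2 - N) := by
      intro r; rw [hB]; unfold hfun; ring
    obtain ⟨sg, hsg, hsgB⟩ : ∃ sg : ℝ, (sg = 1 ∨ sg = -1) ∧ 0 ≤ sg * B := by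
      rcases le_total 0 B with h1 | h1
      · exact ⟨1, Or.inl rfl, by linarith⟩
      · exact ⟨-1, Or.inr rfl, by linarith⟩
    have ha' : c < hfun t₀ N s τ t := ha
    have hgt : ∀ r, 0 ≤ r → c < hfun t₀ N (s - sg * r * β z) (τ - sg * r * α z) (t + sg * r) := by
      intro r hr
      rw [hexp]
      have h1 : 0 ≤ sg * r * B := by have := mul_nonneg hr hsgB; linarith
      have h2 : 0 ≤ (sg * r) ^ 2 * (β z ^ 2 / 8 + α z ^ 2 - N) := mul_nonneg (sq_nonneg _) (by linarith)
      linarith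
    let R : Set ℝ := {r | 0 ≤ r ∧ (s - sg * r * β z) ∈ Icc (0 : ℝ) 2 ∧ (τ - sg * r * α z) ∈ Icc (0 : ℝ) 1 ∧ t + sg * r ∈ Icc (t₀ - δ) (t₀ + δ)}
    have hRc : IsCompact R := by
      refine (isCompact_Icc (a := (0 : ℝ)) (b := 2 * δ)).of_isClosed_subset ?_ ?_
      · refine IsClosed.inter isClosed_Ici (IsClosed.inter ?_ (IsClosed.inter ?_ ?_))
        · exact isClosed_Icc.preimage (f := fun r : ℝ => s - sg * r * β z) (by fun_prop)
        · exact isClosed_Icc.preimage (f := fun r : ℝ => τ - sg * r * α z) (by fun_prop)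
        · exact isClosed_Icc.preimage (f := fun r : ℝ => t + sg * r) (by fun_prop)
      · rintro r ⟨h1, -, -, h2, h3⟩
        refine ⟨h1, ?_⟩
        rcases hsg with rfl | rfl
        · linarith [ht.1]
        · linarith [ht.2]
    have h0R : (0 : ℝ) ∈ R := ⟨le_refl _, by simpa using hs, by simpa using hτ, by simpa using ht⟩
    obtain ⟨r₁, hr₁, hmax⟩ := hRc.exists_isGreatest ⟨0, h0R⟩
    have hconv : ∀ v : I, (v : ℝ) * r₁ ∈ R := by
      intro v
      have hconvex : Convex ℝ R := by
        refine (convex_Ici 0).inter (Convex.inter ?_ (Convex.inter ?_ ?_))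
        · intro x hx y hy a b ha hb hab
          have := convex_Icc (0 : ℝ) 2 hx hy ha hb hab
          simp only [smul_eq_mul] at this
          show s - sg * (a • x + b • y) * β z ∈ Icc (0 : ℝ) 2
          convert this using 1
          simp only [smul_eq_mul]
          linear_combination (-s) * hab
        · intro x hx y hy a b ha hb hab
          have := convex_Icc (0 : ℝ) 1 hx hy ha hb hab
          simp only [smul_eq_mul] at this
          show τ - sg * (a • x + b • y) * α z ∈ Icc (0 : ℝ) 1
          convert this using 1
          simp only [smul_eq_mul]
          linear_combination (-τ) * hab
        · intro x hx y hy a b ha hb hab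
          have := convex_Icc (t₀ - δ) (t₀ + δ) hx hy ha hb hab
          simp only [smul_eq_mul] at this
          show t + sg * (a • x + b • y) ∈ Icc (t₀ - δ) (t₀ + δ)
          convert this using 1
          simp only [smul_eq_mul]
          linear_combination (-t) * hab
      have := hconvex h0R hr₁ (a := 1 - v) (b := v) (by linarith [v.2.2]) v.2.1 (by ring)
      simpa using this
    let x : I → PA t₀ δ := fun v => ⟨⟨_, (hconv v).2.1⟩, ⟨_, (hconv v).2.2.1⟩, ⟨_, (hconv v).2.2.2⟩⟩
    have hxA : ∀ v, x v ∈ Ag := fun v => hcA _ (hgt _ (hconv v).1)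
    have hxc : Continuous x := by
      refine Continuous.prodMk ?_ (Continuous.prodMk ?_ ?_) <;>
      · refine Continuous.subtype_mk ?_ _
        fun_prop
    have hprop := lift_unique hφ (g₁ := fun v : I => G (1, ⟨x v, hxA v⟩))
      (g₂ := fun v : I => (⟨(z, t + sg * ((v : ℝ) * r₁)), hU' _ (hconv v).2.2.2⟩ : U))
      (hGc.comp (continuous_const.prodMk (Continuous.subtype_mk hxc _)))
      (Continuous.subtype_mk (by fun_prop) _)
      (by
        intro v
        rw [hGφ, hφf]
        simp only [F', F, x, ContinuousMap.coe_mk]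
        refine Prod.ext ?_ rfl
        simp only [Set.Icc.coe_one, one_mul]
        have h1 : f z - (t + sg * ((v : ℝ) * r₁)) • z = (w + τ • e + s • n) - (sg * ((v : ℝ) * r₁)) • z := by
          rw [← hfz]; module
        rw [h1]
        conv_rhs => rw [hz z]
        module) 0
      (by
        have hx0 : x 0 = ⟨⟨s, hs⟩, ⟨τ, hτ⟩, ⟨t, ht⟩⟩ := by simp [x]
        simp only [hx0]
        apply Subtype.ext
        refine Prod.ext ?_ ?_
        · exact hzdef.symm
        · simp only [hGt]; simp) 1
    have hfin : (G (1, ⟨x 1, hxA 1⟩)).1.1 = z := by rw [hprop]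
    rw [← hfin]
    apply hM₀
    by_contra hnF
    have hh1 := hgt r₁ hr₁.1
    obtain ⟨hr0, ⟨hs1, hs2⟩, ⟨hτ1, hτ2⟩, ht1, ht2⟩ := hr₁
    have hnF' : ¬ ((s - sg * r₁ * β z) = 0 ∨ (τ - sg * r₁ * α z) = 0 ∨ (τ - sg * r₁ * α z) = 1) := by
      intro h9
      apply hnF
      simp only [Face, x, Set.Icc.coe_one, one_mul]
      exact h9
    push Not at hnF'
    obtain ⟨n1, n2, n3⟩ := hnF'
    obtain ⟨s', hs'⟩ : ∃ s', s' = s - sg * r₁ * β z := ⟨_, rfl⟩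
    obtain ⟨τ', hτ'⟩ : ∃ τ', τ' = τ - sg * r₁ * α z := ⟨_, rfl⟩
    obtain ⟨t', ht'⟩ : ∃ t', t' = t + sg * r₁ := ⟨_, rfl⟩
    rw [← hs'] at hh1 hs1 hs2 n1
    rw [← hτ'] at hh1 hτ1 hτ2 n2 n3
    rw [← ht'] at hh1 ht1 ht2
    have hτq : (τ' - 1 / 2) ^ 2 ≤ 1 / 4 := by nlinarith
    have hsl : s' < 2 := by
      refine lt_of_le_of_ne hs2 ?_
      intro hs2
      rw [hs2] at hh1
      unfold hfun at hh1
      have := mul_nonneg hN0.le (sq_nonneg (t' - t₀))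
      linarith
    have htq : (t' - t₀) ^ 2 ≠ δ ^ 2 := by
      intro h1
      unfold hfun at hh1
      rw [h1, hNδ] at hh1
      nlinarith
    have ht1' : t₀ - δ < t' := lt_of_le_of_ne ht1 (by rintro h1; apply htq; rw [← h1]; ring)
    have ht2' : t' < t₀ + δ := lt_of_le_of_ne ht2 (by rintro h1; apply htq; rw [h1]; ring)
    have hev : ∀ᶠ r in 𝓝 r₁, (s - sg * r * β z) ∈ Ioo (0 : ℝ) 2 ∧ (τ - sg * r * α z) ∈ Ioo (0 : ℝ) 1 ∧ t + sg * r ∈ Ioo (t₀ - δ) (t₀ + δ) := by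
      refine Filter.Eventually.and ?_ (Filter.Eventually.and ?_ ?_)
      · refine ContinuousAt.eventually_mem (f := fun r : ℝ => s - sg * r * β z) (by fun_prop) (isOpen_Ioo.mem_nhds ?_)
        simp only [← hs']; exact ⟨lt_of_le_of_ne hs1 (Ne.symm n1), hsl⟩
      · refine ContinuousAt.eventually_mem (f := fun r : ℝ => τ - sg * r * α z) (by fun_prop) (isOpen_Ioo.mem_nhds ?_)
        simp only [← hτ']; exact ⟨lt_of_le_of_ne hτ1 (Ne.symm n2), lt_of_le_of_ne hτ2 n3⟩
      · refine ContinuousAt.eventually_mem (f := fun r : ℝ => t + sg * r) (by fun_prop) (isOpen_Ioo.mem_nhds ?_)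
        simp only [← ht']; exact ⟨ht1', ht2'⟩
    obtain ⟨r₂, ⟨q1, q2, q3⟩, hr₂⟩ := ((hev.filter_mono nhdsWithin_le_nhds).and
      (self_mem_nhdsWithin : Ioi r₁ ∈ 𝓝[>] r₁)).exists
    have hr₂' : r₁ < r₂ := hr₂
    have := hmax (show r₂ ∈ R from ⟨by linarith, Ioo_subset_Icc_self q1, Ioo_subset_Icc_self q2, Ioo_subset_Icc_self q3⟩)
    linarith
  -- main claim
  have main : ∀ a, 0 ≤ h a → a ∈ Ag := by
    by_contra! hcon
    obtain ⟨a₀, ha₀, ha₀'⟩ := hcon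
    have hDc : IsCompact (Agᶜ ∩ {a | 0 ≤ h a}) :=
      (hAgo.isClosed_compl.inter (isClosed_le continuous_const hhc)).isCompact
    obtain ⟨a, ⟨haA, hac⟩, hmax⟩ := hDc.exists_isMaxOn ⟨a₀, ha₀', ha₀⟩ hhc.continuousOn
    have hcA : ∀ b, h a < h b → b ∈ Ag := by
      intro b hb
      by_contra hbA
      have : h b ≤ h a := hmax (show b ∈ Agᶜ ∩ {a | 0 ≤ h a} from ⟨hbA, le_trans hac hb.le⟩)
      linarith
    apply haA
    obtain ⟨s, τ, t⟩ := a
    have hsp : (0 : ℝ) < s := lt_of_le_of_ne s.2.1 (fun h1 => haA (hs0 _ h1.symm))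
    let P : C(I, V × ℝ) := ⟨fun u => F (u, (s, τ, t)), by fun_prop⟩
    obtain ⟨M, hM⟩ : ∃ M, M = max M₀ ((N + 1) * ‖e‖ + (8 * N + 1) * ‖n‖) := ⟨_, rfl⟩
    have hKc : IsCompact (closedBall (0 : V) M ×ˢ (Icc (t₀ - δ) (t₀ + δ))) := (isCompact_closedBall _ _).prod isCompact_Icc
    refine lift_ext hφ P (g (τ, t)) (by simp [P, F, hgφ]) (Subtype.val ⁻¹' (closedBall (0 : V) M ×ˢ (Icc (t₀ - δ) (t₀ + δ)))) ?_ ?_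
    · refine IsEmbedding.subtypeVal.isInducing.isCompact_preimage_iff ?_ |>.2 hKc
      rw [Subtype.range_coe, hU]
      rintro ⟨z, t'⟩ ⟨-, h2⟩
      exact hJ h2
    · intro u hu γ hγ0 hγ
      let b : PA t₀ δ := (⟨u * s, by have := u.2.1; positivity, by nlinarith [u.2.1, u.2.2, s.2.2]⟩, τ, t)
      have hbA : b ∈ Ag := by
        refine ⟨γ, hγ0, fun v => ?_⟩
        rw [hγ]
        simp only [P, F, b, ContinuousMap.coe_mk, Set.Icc.coe_mul]
        refine Prod.ext ?_ rfl
        simp only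
        congr 2; ring
      have hγ1 : γ 1 = G (1, ⟨b, hbA⟩) := by
        refine lift_unique hφ (g₁ := γ) (g₂ := fun v : I => G (v, ⟨b, hbA⟩)) γ.continuous (by fun_prop) ?_ 0 ?_ 1
        · intro v
          rw [hγ, hGφ]
          simp only [P, F', F, b, ContinuousMap.coe_mk, Set.Icc.coe_mul]
          refine Prod.ext ?_ rfl
          simp only
          congr 2; ring
        · simp only [hG0, hγ0, b]
      have hb : h (s, τ, t) < h b := by
        have h1 : (u : ℝ) < 1 := hu
        have h2 := s.2.2
        have h3 := u.2.1
        have h4 : 0 < (s - u * s : ℝ) := by nlinarith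
        have h5 : 0 < (1 - (s + u * s) / 8 : ℝ) := by nlinarith
        have h6 := mul_pos h4 h5
        simp only [h, b, hfun]
        nlinarith
      rw [hγ1]
      have hbd := bound (h (s, τ, t)) hac hcA ⟨b, hbA⟩ hb
      constructor
      · rw [mem_closedBall_zero_iff, hM]
        rcases le_or_gt N (β (G (1, ⟨b, hbA⟩)).1.1 ^ 2 / 8 + α (G (1, ⟨b, hbA⟩)).1.1 ^ 2) with h1 | h1
        · exact (hbd h1).trans (le_max_left _ _)
        · refine le_trans ?_ (le_max_right _ _)
          obtain ⟨z, hzd⟩ : ∃ z, z = (G (1, ⟨b, hbA⟩)).1.1 := ⟨_, rfl⟩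
          rw [← hzd] at h1 ⊢
          have h2 : ‖z‖ ≤ |α z| * ‖e‖ + |β z| * ‖n‖ := by
            conv_lhs => rw [hz z]
            refine (norm_add_le _ _).trans ?_
            rw [norm_smul, norm_smul, Real.norm_eq_abs, Real.norm_eq_abs]
          have h3 : |α z| ≤ N + 1 := by
            refine abs_le_of_sq_le_sq ?_ (by linarith)
            nlinarith [sq_nonneg (β z)]
          have h4 : |β z| ≤ 8 * N + 1 := by
            refine abs_le_of_sq_le_sq ?_ (by linarith)
            nlinarith [sq_nonneg (α z)]
          refine h2.trans ?_
          gcongr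
      · have h7 : φ (G (1, ⟨b, hbA⟩)) = F' (1, ⟨b, hbA⟩) := hGφ _
        rw [hφf] at h7
        have h8 : (G (1, ⟨b, hbA⟩)).1.2 = (t : ℝ) := congrArg Prod.snd h7
        rw [h8]; exact t.2
  -- the diagonal
  let dg : I → PA t₀ δ := fun u => (⟨u, u.2.1, by linarith [u.2.2]⟩, u, ⟨t₀, ht₀⟩)
  have hdg : ∀ u, dg u ∈ Ag := by
    intro u
    apply main
    simp only [h, dg, hfun]
    nlinarith [u.2.1, u.2.2, sq_nonneg ((u : ℝ) - 8 / 9)]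
  have hdgc : Continuous dg := by
    refine Continuous.prodMk ?_ (Continuous.prodMk continuous_id continuous_const)
    exact Continuous.subtype_mk (by fun_prop) _
  refine ⟨⟨fun u => G (1, ⟨dg u, hdg u⟩), hGc.comp (continuous_const.prodMk (Continuous.subtype_mk hdgc _))⟩,
    ⟨fun u => G (u, ⟨dg 1, hdg 1⟩), by fun_prop⟩, ?_, ?_, rfl, ?_, ?_⟩
  · have := lift_unique hφ (g₁ := fun v : I => G (v, ⟨dg 0, hdg 0⟩)) (g₂ := fun _ => g (0, ⟨t₀, ht₀⟩))
      (by fun_prop) continuous_const (by intro v; rw [hGφ, hgφ]; simp [F', F, dg]) 0 (by rw [hG0]) 1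
    exact this
  · simp only [ContinuousMap.coe_mk, hG0]; rfl
  · intro u
    simp only [ContinuousMap.coe_mk, hGφ, F', F, dg]
    refine Prod.ext ?_ rfl
    simp only [Set.Icc.coe_one, one_mul]
    module
  · intro u
    simp only [ContinuousMap.coe_mk, hGφ, F', F, dg]
    refine Prod.ext ?_ rfl
    simp only [Set.Icc.coe_one, mul_one, one_smul]

end core
section slice
open unitInterval

theorem coords (e q : Plane) (h : e 0 * q 1 - e 1 * q 0 ≠ 0) :
    ∃ α β : Plane → ℝ, ∀ z, z = α z • e + β z • (q - e) := by
  obtain ⟨D, hD⟩ : ∃ D, D = e 0 * q 1 - e 1 * q 0 := ⟨_, rfl⟩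
  rw [← hD] at h
  refine ⟨fun z => (z 0 * (q 1 - e 1) - z 1 * (q 0 - e 0)) / D,
    fun z => (e 0 * z 1 - e 1 * z 0) / D, fun z => ?_⟩
  ext i
  fin_cases i
  · simp; field_simp; rw [hD]; ring
  · simp; field_simp; rw [hD]; ring

theorem off_line (w q : Plane) (hq : q ≠ 0) (O : Set Plane) (hO : IsOpen O) (hne : O.Nonempty) :
    ∃ v ∈ O, (v - w) 0 * q 1 - (v - w) 1 * q 0 ≠ 0 := by
  obtain ⟨v, hv⟩ := hne
  by_cases h : (v - w) 0 * q 1 - (v - w) 1 * q 0 = 0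
  · have hc : Tendsto (fun k : ℝ => v + k • (!₂[-q 1, q 0] : Plane)) (𝓝[>] 0) (𝓝 v) := by
      have : Continuous (fun k : ℝ => v + k • (!₂[-q 1, q 0] : Plane)) := by fun_prop
      have h2 := this.tendsto 0
      simp only [zero_smul, add_zero] at h2
      exact h2.mono_left nhdsWithin_le_nhds
    obtain ⟨k, hk, hk0⟩ := ((hc.eventually_mem (hO.mem_nhds hv)).and
      (self_mem_nhdsWithin : Ioi (0 : ℝ) ∈ 𝓝[>] 0)).exists
    refine ⟨_, hk, ?_⟩
    have hk0' : (0 : ℝ) < k := hk0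
    have hpos : 0 < q 0 ^ 2 + q 1 ^ 2 := by
      by_contra hcon
      apply hq
      ext i
      fin_cases i
      · simp; nlinarith [sq_nonneg (q 0), sq_nonneg (q 1)]
      · simp; nlinarith [sq_nonneg (q 0), sq_nonneg (q 1)]
    have := mul_pos hk0' hpos
    simp at h ⊢
    intro h3
    nlinarith
  · exact ⟨v, hv, h⟩

theorem slice_inj {ε : ℝ} {U : Set (Plane × ℝ)} (hU : U = {x : Plane × ℝ | x.2 ∈ Ioo 0 ε})
    {f : Plane → Plane} {φ : U → Plane × ℝ}
    (hφ : IsLocalHomeomorph φ)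
    (hφf : ∀ x : U, φ x = (f x.1.1 - x.1.2 • x.1.1, x.1.2))
    (hfc : Continuous f) {t₀ : ℝ} (ht₀ : t₀ ∈ Ioo 0 ε) (hop : IsOpenMap (fun z => f z - t₀ • z)) :
    Injective (fun z => f z - t₀ • z) := by
  let ft : Plane → Plane := fun z => f z - t₀ • z
  have hftc : Continuous ft := by unfold ft; fun_prop
  let pt : Plane → U := fun z => ⟨(z, t₀), by rw [hU]; exact ht₀⟩
  have hptc : Continuous pt := Continuous.subtype_mk (by fun_prop) _
  have hφpt : ∀ z, φ (pt z) = (ft z, t₀) := fun z => hφf _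
  have hptinj : Injective pt := by
    intro a b h
    exact congrArg (fun x : U => x.1.1) h
  intro q p hqp
  have hqp' : ft q = ft p := hqp
  let F : C(I × Plane, Plane × ℝ) := ⟨fun z => (ft p + (z.1 : ℝ) • (ft z.2 - ft p), t₀), by fun_prop⟩
  let Z : Set Plane := {z | ∃ γ : C(I, U), γ 0 = pt p ∧ γ 1 = pt z ∧ ∀ u, φ (γ u) = F (u, z)}
  have hZo : IsOpen Z := by
    let Gd : Set Plane := {z | ∃ γ : C(I, U), γ 0 = pt p ∧ ∀ u, φ (γ u) = F (u, z)}
    have hGo : IsOpen Gd := lift_open hφ F (fun _ => pt p) continuous_const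
      (fun a => by rw [hφpt]; simp [F])
    let F' : C(I × Gd, Plane × ℝ) := ⟨fun z => F (z.1, z.2.1), by fun_prop⟩
    obtain ⟨G, hGc, hG0, hGφ⟩ := lift_cont hφ F' (fun _ => pt p) continuous_const (fun a => a.2)
    have hE : IsOpen {a : Gd | G (1, a) = pt a} := by
      refine hφ.isLocallyInjective.isOpen_eqLocus (g₁ := fun a : Gd => G (1, a)) (g₂ := fun a : Gd => pt a)
        (by fun_prop) (by fun_prop) ?_
      ext1 a
      simp only [comp_apply, hGφ, hφpt, F', F, ContinuousMap.coe_mk]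
      simp
    have : Z = Subtype.val '' {a : Gd | G (1, a) = pt a} := by
      ext z; constructor
      · rintro ⟨γ, h1, h2, h3⟩
        refine ⟨⟨z, γ, h1, h3⟩, ?_, rfl⟩
        have := lift_unique hφ (g₁ := fun v : I => G (v, ⟨z, γ, h1, h3⟩)) (g₂ := γ)
          (by fun_prop) γ.continuous (fun v => by rw [hGφ, h3]; rfl) 0 (by rw [hG0, h1]) 1
        exact this.trans h2
      · rintro ⟨⟨z, hz⟩, h, rfl⟩
        exact ⟨⟨fun v => G (v, ⟨z, hz⟩), by fun_prop⟩, hG0 _, h, fun u => hGφ _⟩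
    rw [this]
    exact hGo.isOpenMap_subtype_val _ hE
  have hpZ : p ∈ Z := ⟨ContinuousMap.const _ (pt p), rfl, rfl, fun u => by simp [F, hφpt]⟩
  have hZc : IsClosed Z := by
    rw [← closure_subset_iff_isClosed]
    intro zs hzs
    obtain ⟨ψp, hψp, hψpφ⟩ := hφ (pt p)
    obtain ⟨ψs, hψs, hψsφ⟩ := hφ (pt zs)
    have hTp : (ft p, t₀) ∈ ψp.target := by
      have := ψp.map_source hψp; rwa [← hψpφ, hφpt] at this
    have hTs : (ft zs, t₀) ∈ ψs.target := by
      have := ψs.map_source hψs; rwa [← hψsφ, hφpt] at this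
    have hpp : ψp.symm (ft p, t₀) = pt p := by
      rw [← hφpt, hψpφ]; exact ψp.left_inv hψp
    have hss : ψs.symm (ft zs, t₀) = pt zs := by
      rw [← hφpt, hψsφ]; exact ψs.left_inv hψs
    have hrp : ∀ y ∈ ψp.target, φ (ψp.symm y) = y := fun y hy => by
      rw [hψpφ]; exact ψp.right_inv hy
    have hrs : ∀ y ∈ ψs.target, φ (ψs.symm y) = y := fun y hy => by
      rw [hψsφ]; exact ψs.right_inv hy
    obtain ⟨ηp, hηp, hηpb⟩ := Metric.isOpen_iff.1 ψp.open_target _ hTp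
    obtain ⟨ηs, hηs, hηsb⟩ := Metric.isOpen_iff.1 ψs.open_target _ hTs
    have hinp : ∀ v t, ‖v - ft p‖ < ηp → |t - t₀| < ηp → (v, t) ∈ ψp.target := by
      intro v t h1 h2
      apply hηpb
      rw [mem_ball, Prod.dist_eq, max_lt_iff, dist_eq_norm, Real.dist_eq]
      exact ⟨h1, h2⟩
    have hins : ∀ v t, ‖v - ft zs‖ < ηs → |t - t₀| < ηs → (v, t) ∈ ψs.target := by
      intro v t h1 h2
      apply hηsb
      rw [mem_ball, Prod.dist_eq, max_lt_iff, dist_eq_norm, Real.dist_eq]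
      exact ⟨h1, h2⟩
    by_cases hv : ft zs = ft p
    · -- same value
      have : NeBot (𝓝[Z] zs) := mem_closure_iff_nhdsWithin_neBot.1 hzs
      have h1 : Tendsto pt (𝓝[Z] zs) (𝓝 (pt zs)) := hptc.continuousAt.continuousWithinAt
      have h2 : Tendsto pt (𝓝[Z] zs) (𝓝 (pt p)) := by
        have h3 : Tendsto (fun z => ψp.symm (ft z, t₀)) (𝓝[Z] zs) (𝓝 (ψp.symm (ft p, t₀))) := by
          have h4 : ContinuousAt ψp.symm (ft p, t₀) := ψp.continuousAt_symm hTp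
          have h5 : Tendsto (fun z => (ft z, t₀)) (𝓝 zs) (𝓝 (ft p, t₀)) := by
            rw [← hv]
            exact (Continuous.tendsto (by fun_prop) zs)
          exact (h4.tendsto.comp h5).mono_left nhdsWithin_le_nhds
        rw [hpp] at h3
        refine h3.congr' ?_
        have h6 : ∀ᶠ z in 𝓝 zs, ‖ft z - ft p‖ < ηp := by
          have : ContinuousAt (fun z => ‖ft z - ft p‖) zs := Continuous.continuousAt (by fun_prop)
          refine this.eventually_lt continuousAt_const ?_
          simpa [hv] using hηp
        filter_upwards [mem_nhdsWithin_of_mem_nhds h6, self_mem_nhdsWithin] with z hz6 hzZ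
        obtain ⟨γ, g1, g2, g3⟩ := hzZ
        have hin : ∀ u : I, (ft p + (u : ℝ) • (ft z - ft p), t₀) ∈ ψp.target := by
          intro u
          refine hinp _ _ ?_ (by simpa using hηp)
          rw [add_sub_cancel_left, norm_smul, Real.norm_eq_abs, abs_of_nonneg u.2.1]
          exact lt_of_le_of_lt (mul_le_of_le_one_left (norm_nonneg _) u.2.2) hz6
        have := lift_unique hφ (g₁ := γ) (g₂ := fun u : I => ψp.symm (ft p + (u : ℝ) • (ft z - ft p), t₀))
          γ.continuous (ψp.continuousOn_symm.comp_continuous (by fun_prop) hin)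
          (fun u => by rw [hrp _ (hin u), g3]; rfl) 0 (by simp [g1, hpp]) 1
        rw [g2] at this
        rw [this]; simp
      have h3 := hptinj (tendsto_nhds_unique h1 h2)
      rw [h3]; exact hpZ
    · -- choose z₀
      obtain ⟨η, hη, hη1, hη2⟩ : ∃ η > 0, 3 * η ≤ ηp ∧ 3 * η ≤ ηs :=
        ⟨min ηp ηs / 3, by positivity, by linarith [min_le_left ηp ηs], by linarith [min_le_right ηp ηs]⟩
      let O : Set Plane := Z ∩ (pt ⁻¹' ψs.source ∩ {z | ‖ft z - ft zs‖ < η})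
      have hN : IsOpen (pt ⁻¹' ψs.source ∩ {z | ‖ft z - ft zs‖ < η}) :=
        (ψs.open_source.preimage hptc).inter (isOpen_lt (by fun_prop) continuous_const)
      have hOo : IsOpen O := hZo.inter hN
      have hOne : O.Nonempty := by
        have := mem_closure_iff.1 hzs _ hN ⟨hψs, by simpa using hη⟩
        rwa [inter_comm] at this
      obtain ⟨_, ⟨z₀, ⟨hz₀Z, hz₀s, hz₀η⟩, rfl⟩, hdet⟩ := off_line (ft p) (ft zs - ft p) (sub_ne_zero.2 hv) (ft '' O)
        (hop O hOo) (hOne.image ft)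
      have hz₀η' : ‖ft z₀ - ft zs‖ < η := hz₀η
      obtain ⟨α, β, hαβ⟩ := coords _ _ hdet
      have hn : ft zs - ft p - (ft z₀ - ft p) = ft zs - ft z₀ := by abel
      rw [hn] at hαβ
      obtain ⟨e, he⟩ : ∃ e, e = ft z₀ - ft p := ⟨_, rfl⟩
      obtain ⟨n, hnd⟩ : ∃ n, n = ft zs - ft z₀ := ⟨_, rfl⟩
      rw [← he, ← hnd] at hαβ
      have hnη : ‖n‖ < η := by rw [hnd, norm_sub_rev]; exact hz₀η'
      have hpe : ft p + e = ft z₀ := by rw [he]; abel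
      -- choose δ
      let T : Set ℝ := {t | (ft p, t) ∈ ψp.target}
      have hTo : IsOpen T := ψp.open_target.preimage (by fun_prop)
      let c : T → U := fun t => ψp.symm (ft p, (t : ℝ))
      have hcc : Continuous c := ψp.continuousOn_symm.comp_continuous (by fun_prop) (fun t => t.2)
      let F₁ : C(I × T, Plane × ℝ) := ⟨fun z => (ft p + (z.1 : ℝ) • e, (z.2 : ℝ)), by fun_prop⟩
      have hgood : IsOpen {t : T | ∃ γ : C(I, U), γ 0 = c t ∧ ∀ u, φ (γ u) = F₁ (u, t)} :=
        lift_open hφ F₁ c hcc (fun t => by simp only [c]; rw [hrp _ t.2]; simp [F₁])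
      have hgood' := hTo.isOpenMap_subtype_val _ hgood
      have ht₀good : t₀ ∈ (Subtype.val '' {t : T | ∃ γ : C(I, U), γ 0 = c t ∧ ∀ u, φ (γ u) = F₁ (u, t)} : Set ℝ) := by
        obtain ⟨γ, g1, g2, g3⟩ := hz₀Z
        refine ⟨⟨t₀, hTp⟩, ⟨γ, ?_, fun u => ?_⟩, rfl⟩
        · simp only [c, hpp, g1]
        · rw [g3]; simp [F, F₁, he]
      obtain ⟨δ₀, hδ₀, hδ₀b⟩ := nhds_basis_closedBall.mem_iff.1
        (inter_mem (hgood'.mem_nhds ht₀good) (isOpen_Ioo.mem_nhds ht₀))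
      obtain ⟨δ, hδ, hδ1, hδ2⟩ : ∃ δ > 0, δ ≤ δ₀ ∧ δ ≤ η :=
        ⟨min δ₀ η, by positivity, min_le_left _ _, min_le_right _ _⟩
      have hJb : Icc (t₀ - δ) (t₀ + δ) ⊆ closedBall t₀ δ₀ := by
        rw [Real.closedBall_eq_Icc]; exact Icc_subset_Icc (by linarith) (by linarith)
      have hJη : ∀ t ∈ Icc (t₀ - δ) (t₀ + δ), |t - t₀| ≤ η := by
        intro t ht; rw [abs_le]; constructor <;> linarith [ht.1, ht.2]
      have hJ0 : t₀ ∈ Icc (t₀ - δ) (t₀ + δ) := ⟨by linarith, by linarith⟩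
      have hJT : ∀ t ∈ Icc (t₀ - δ) (t₀ + δ), (ft p, t) ∈ ψp.target := by
        intro t ht
        exact hinp _ _ (by simpa using hηp) (by linarith [hJη t ht])
      let F₂ : C(I × Icc (t₀ - δ) (t₀ + δ), Plane × ℝ) := ⟨fun z => (ft p + (z.1 : ℝ) • e, (z.2 : ℝ)), by fun_prop⟩
      obtain ⟨g, hgc, hg0, hgφ⟩ := lift_cont hφ F₂ (fun t => ψp.symm (ft p, (t : ℝ)))
        (ψp.continuousOn_symm.comp_continuous (by fun_prop) (fun t => hJT t t.2))
        (by
          rintro ⟨t, ht⟩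
          obtain ⟨⟨t', ht'⟩, ⟨γ, g1, g2⟩, rfl⟩ := (hδ₀b (hJb ht)).1
          exact ⟨γ, g1, g2⟩)
      have hconn : PreconnectedSpace (Icc (t₀ - δ) (t₀ + δ)) := Subtype.preconnectedSpace isPreconnected_Icc
      have hright : ∀ (t : Icc (t₀ - δ) (t₀ + δ)) (x : ℝ), x ∈ Icc (0 : ℝ) 2 → (ft p + e + x • n, (t : ℝ)) ∈ ψs.target := by
        intro t x hx
        refine hins _ _ ?_ (by linarith [hJη t t.2])
        have : ft p + e + x • n - ft zs = (x - 1) • n := by rw [hpe, hnd]; module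
        rw [this, norm_smul, Real.norm_eq_abs]
        have h1 : |x - 1| ≤ 1 := by rw [abs_le]; constructor <;> linarith [hx.1, hx.2]
        have := mul_le_of_le_one_left (norm_nonneg n) h1
        linarith
      have hleft : ∀ (t : Icc (t₀ - δ) (t₀ + δ)) (x : ℝ), x ∈ Icc (0 : ℝ) 2 → (ft p + x • n, (t : ℝ)) ∈ ψp.target := by
        intro t x hx
        refine hinp _ _ ?_ (by linarith [hJη t t.2])
        rw [add_sub_cancel_left, norm_smul, Real.norm_eq_abs, abs_of_nonneg hx.1]
        have := mul_le_mul_of_nonneg_right hx.2 (norm_nonneg n)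
        linarith
      have hright0 : ∀ (t : Icc (t₀ - δ) (t₀ + δ)), (ft p + e, (t : ℝ)) ∈ ψs.target := by
        intro t
        have := hright t 0 ⟨le_refl _, by norm_num⟩
        simpa using this
      have hg1 : ∀ t, g (1, t) = ψs.symm (ft p + e, (t : ℝ)) := by
        have hg1t : g (1, ⟨t₀, hJ0⟩) = pt z₀ := by
          obtain ⟨γ, g1, g2, g3⟩ := hz₀Z
          rw [← g2]
          refine lift_unique hφ (g₁ := fun u : I => g (u, ⟨t₀, hJ0⟩)) (g₂ := γ) (by fun_prop) γ.continuous ?_ 0 ?_ 1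
          · intro u; rw [hgφ, g3, ]; simp [F₂, F, he]
          · simp only [hg0, hpp, g1]
        refine lift_unique hφ (g₁ := fun t => g (1, t)) (g₂ := fun t => ψs.symm (ft p + e, (t : ℝ)))
          (by fun_prop) (ψs.continuousOn_symm.comp_continuous (by fun_prop) hright0) ?_ ⟨t₀, hJ0⟩ ?_
        · intro t
          simp only [hgφ, hrs _ (hright0 t)]
          simp [F₂]
        · simp only [hg1t]
          rw [hpe, ← hφpt, hψsφ]; exact (ψs.left_inv hz₀s).symm
      obtain ⟨d, γ, hd0, hγ0, hγ1, hdφ, hγφ⟩ := core hU hφ hφf α β hαβ hδ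
        (fun t ht => (hδ₀b (hJb ht)).2) g hgc (fun a => hgφ a) (by
          intro s τ t hτ
          have hus : ∀ u : I, (u : ℝ) * s ∈ Icc (0 : ℝ) 2 := fun u =>
            ⟨mul_nonneg u.2.1 s.2.1, (mul_le_of_le_one_left s.2.1 u.2.2).trans s.2.2⟩
          rcases hτ with rfl | rfl
          · refine ⟨⟨fun u => ψp.symm (ft p + ((u : ℝ) * s) • n, (t : ℝ)),
              ψp.continuousOn_symm.comp_continuous (by fun_prop) (fun u => hleft t _ (hus u))⟩, ?_, ?_⟩
            · simp [hg0]
            · intro u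
              simp only [ContinuousMap.coe_mk]
              rw [hrp _ (hleft t _ (hus u))]
              simp
          · refine ⟨⟨fun u => ψs.symm (ft p + e + ((u : ℝ) * s) • n, (t : ℝ)),
              ψs.continuousOn_symm.comp_continuous (by fun_prop) (fun u => hright t _ (hus u))⟩, ?_, ?_⟩
            · simp [hg1]
            · intro u
              simp only [ContinuousMap.coe_mk]
              rw [hrs _ (hright t _ (hus u))]
              simp) hJ0
      have hu2 : ∀ u : I, (u : ℝ) ∈ Icc (0 : ℝ) 2 := fun u => ⟨u.2.1, by linarith [u.2.2]⟩
      have hγe := lift_unique hφ (g₁ := γ) (g₂ := fun u : I => ψs.symm (ft p + e + (u : ℝ) • n, t₀))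
        γ.continuous (ψs.continuousOn_symm.comp_continuous (by fun_prop) (fun u => hright ⟨t₀, hJ0⟩ _ (hu2 u)))
        (fun u => by rw [hγφ, hrs _ (hright ⟨t₀, hJ0⟩ _ (hu2 u))]) 0 (by simp [hγ0, hg1]) 1
      refine ⟨d, ?_, ?_, ?_⟩
      · rw [hd0, hg0]; exact hpp
      · rw [← hγ1, hγe, ← hss, hpe, hnd]; simp
      · intro u
        rw [hdφ]
        have : e + n = ft zs - ft p := by rw [he, hnd]; abel
        simp [F, this]
  have hZu : Z = univ := IsClopen.eq_univ ⟨hZc, hZo⟩ ⟨p, hpZ⟩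
  obtain ⟨γ, h1, h2, h3⟩ : q ∈ Z := hZu ▸ mem_univ q
  have := lift_unique hφ (g₁ := γ) (g₂ := fun _ : I => pt p) γ.continuous continuous_const
    (fun u => by rw [h3, hφpt]; simp [F, hqp']) 0 h1 1
  rw [h2] at this
  exact hptinj this

end slice
theorem eig_of (L : Plane →L[ℝ] Plane) (t : ℝ) (v : Plane) (hv : v ≠ 0) (h : L v = t • v) :
    IsEigenvalueCLM L (t : ℂ) := by
  have h1 : Module.End.HasEigenvalue (L.toLinearMap : Module.End ℝ Plane) t :=
    Module.End.hasEigenvalue_of_hasEigenvector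
      (Module.End.hasEigenvector_iff.2 ⟨Module.End.mem_eigenspace_iff.2 h, hv⟩)
  have h2 : (LinearMap.charpoly (L.toLinearMap : Module.End ℝ Plane)).IsRoot t :=
    (Module.End.hasEigenvalue_iff_isRoot_charpoly _ _).1 h1
  unfold IsEigenvalueCLM
  rw [Matrix.charpoly_map, LinearMap.charpoly_toMatrix]
  exact h2.map (f := algebraMap ℝ ℂ)

theorem bij_of (Df : Plane → Plane →L[ℝ] Plane) (ε : ℝ)
    (hspec : spec Df ∩ (Complex.ofReal '' Ico (0 : ℝ) ε) = ∅) (p : Plane) (t : ℝ)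
    (ht : t ∈ Ico 0 ε) : Bijective (Df p - t • ContinuousLinearMap.id ℝ Plane) := by
  have hi : Injective (Df p - t • ContinuousLinearMap.id ℝ Plane) := by
    rw [injective_iff_map_eq_zero]
    intro v hv
    by_contra hne
    have h : Df p v = t • v := by simpa [sub_eq_zero] using hv
    have : (t : ℂ) ∈ spec Df ∩ (Complex.ofReal '' Ico (0 : ℝ) ε) :=
      ⟨⟨p, eig_of _ _ v hne h⟩, t, ht, rfl⟩
    rw [hspec] at this
    exact this
  exact ⟨hi, (LinearMap.injective_iff_surjective
    (f := (Df p - t • ContinuousLinearMap.id ℝ Plane).toLinearMap)).1 hi⟩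

theorem slice_all (f : Plane → Plane) (Df : Plane → Plane →L[ℝ] Plane)
    (hdiff : ∀ p : Plane, HasFDerivAt f (Df p) p) (ε : ℝ)
    (hb : ∀ p, ∀ t ∈ Ico 0 ε, Bijective (Df p - t • ContinuousLinearMap.id ℝ Plane))
    (hd : ∀ (t : ℝ) p, HasFDerivAt (fun z => f z - t • z) (Df p - t • ContinuousLinearMap.id ℝ Plane) p)
    (hop : ∀ t ∈ Ico 0 ε, IsOpenMap (fun z => f z - t • z))
    (t : ℝ) (ht : t ∈ Ioo 0 ε) : Injective (fun z => f z - t • z) := by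
  have hfc : Continuous f := continuous_iff_continuousAt.2 fun p => (hdiff p).continuousAt
  let U : Set (Plane × ℝ) := {x | x.2 ∈ Ioo 0 ε}
  have hUo : IsOpen U := isOpen_Ioo.preimage continuous_snd
  let W := WithLp.prodContinuousLinearEquiv 2 ℝ Plane ℝ
  let A : Plane × ℝ → (Plane × ℝ →L[ℝ] Plane × ℝ) := fun x =>
    ((Df x.1).comp (ContinuousLinearMap.fst ℝ Plane ℝ) -
      (x.2 • ContinuousLinearMap.fst ℝ Plane ℝ +
        (ContinuousLinearMap.snd ℝ Plane ℝ).smulRight x.1)).prod (ContinuousLinearMap.snd ℝ Plane ℝ)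
  let B : Plane × ℝ → (Plane × ℝ →L[ℝ] WithLp 2 (Plane × ℝ)) := fun x =>
    (W.symm : Plane × ℝ →L[ℝ] WithLp 2 (Plane × ℝ)).comp (A x)
  let g : Plane × ℝ → WithLp 2 (Plane × ℝ) := fun x => W.symm (f x.1 - x.2 • x.1, x.2)
  have hg : ∀ x ∈ U, HasFDerivAt g (B x) x := by
    intro x _
    have h1 : HasFDerivAt (fun x : Plane × ℝ => f x.1)
        ((Df x.1).comp (ContinuousLinearMap.fst ℝ Plane ℝ)) x :=
      (hdiff x.1).comp x hasFDerivAt_fst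
    have h2 : HasFDerivAt (fun x : Plane × ℝ => x.2 • x.1) (x.2 • ContinuousLinearMap.fst ℝ Plane ℝ +
        (ContinuousLinearMap.snd ℝ Plane ℝ).smulRight x.1) x :=
      (hasFDerivAt_snd (𝕜 := ℝ) (E := Plane) (F := ℝ) (p := x)).smul hasFDerivAt_fst
    have h3 : HasFDerivAt (fun x : Plane × ℝ => (f x.1 - x.2 • x.1, x.2)) (A x) x :=
      (h1.sub h2).prodMk hasFDerivAt_snd
    exact (W.symm : Plane × ℝ →L[ℝ] WithLp 2 (Plane × ℝ)).hasFDerivAt.comp x h3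
  have hB : ∀ x ∈ U, Bijective (B x) := by
    intro x hx
    have hbx := hb x.1 x.2 ⟨hx.1.le, hx.2⟩
    refine W.symm.bijective.comp (?_ : Bijective (A x))
    constructor
    · rw [injective_iff_map_eq_zero]
      rintro ⟨v, s⟩ hv
      simp only [A, ContinuousLinearMap.prod_apply, Prod.mk_eq_zero] at hv
      have hs : s = 0 := by simpa using hv.2
      subst hs
      have h0 : (Df x.1 - x.2 • ContinuousLinearMap.id ℝ Plane) v = 0 := by simpa using hv.1
      rw [(injective_iff_map_eq_zero _).1 hbx.1 v h0]; rfl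
    · rintro ⟨w, s⟩
      obtain ⟨v, hv⟩ := hbx.2 (w + s • x.1)
      refine ⟨(v, s), ?_⟩
      have hv' : Df x.1 v - x.2 • v = w + s • x.1 := by simpa using hv
      simp only [A, ContinuousLinearMap.prod_apply]
      ext1
      · simp
        rw [← sub_sub, hv']; abel
      · simp
  have hloc := local_homeo hUo hg hB
  let φ : U → Plane × ℝ := fun x => W (g x)
  have hφ : IsLocalHomeomorph φ := W.toHomeomorph.isLocalHomeomorph.comp hloc
  refine slice_inj (U := U) rfl hφ (fun x => ?_) hfc ht (hop t ⟨ht.1.le, ht.2⟩)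
  simp [φ, g]


/-- Fernandes–Gutierrez–Rabanal: a differentiable map of the plane with
`Spec(f) ∩ [0, ε) = ∅` is a topological embedding (in particular injective). -/
theorem stmt2 (f : Plane → Plane) (Df : Plane → Plane →L[ℝ] Plane)
    (hdiff : ∀ p : Plane, HasFDerivAt f (Df p) p)
    (ε : ℝ) (hε : 0 < ε)
    (hspec : spec Df ∩ (Complex.ofReal '' Ico (0 : ℝ) ε) = ∅) :
    Topology.IsEmbedding f ∧ Function.Injective f := by
  have hb : ∀ p, ∀ t ∈ Ico 0 ε, Bijective (Df p - t • ContinuousLinearMap.id ℝ Plane) :=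
    fun p t ht => bij_of Df ε hspec p t ht
  have hd : ∀ (t : ℝ) p, HasFDerivAt (fun z => f z - t • z)
      (Df p - t • ContinuousLinearMap.id ℝ Plane) p :=
    fun t p => (hdiff p).sub ((hasFDerivAt_id p).const_smul t)
  have hfc : Continuous f := continuous_iff_continuousAt.2 fun p => (hdiff p).continuousAt
  have hop : ∀ t ∈ Ico 0 ε, IsOpenMap (fun z => f z - t • z) := by
    intro t ht
    rw [isOpenMap_iff_nhds_le]
    intro x
    rw [le_map_iff]
    intro N hN
    exact open_at isOpen_univ (fun x _ => hd t x) (fun x _ => hb x t ht) x (mem_univ _) N hN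
  have hop0 : IsOpenMap f := by simpa using hop 0 ⟨le_rfl, hε⟩
  have hinj : Injective f := by
    intro p q hpq
    by_contra hne
    have hDi : ∀ x, Injective (Df x) := fun x => by
      simpa using (hb x 0 ⟨le_rfl, hε⟩).1
    obtain ⟨m, hm, hmb⟩ := lower_bd (hdiff p) (hDi p)
    obtain ⟨n, hn, hnb⟩ := lower_bd (hdiff q) (hDi q)
    have hm' : (0 : ℝ) < m := by exact_mod_cast hm
    have hn' : (0 : ℝ) < n := by exact_mod_cast hn
    have hdpq : 0 < dist p q := dist_pos.2 hne
    obtain ⟨r, hr, hrm, hrn, hrd⟩ : ∃ r > 0, r < 1 / (m : ℝ) ∧ r < 1 / (n : ℝ) ∧ 2 * r < dist p q := by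
      have h0 : 0 < min (1 / (m : ℝ)) (min (1 / (n : ℝ)) (dist p q / 2)) := by positivity
      obtain ⟨r, hr, hr2⟩ := exists_between h0
      simp only [lt_min_iff] at hr2
      exact ⟨r, hr, hr2.1, hr2.2.1, by linarith [hr2.2.2]⟩
    have key : ∀ (x : Plane) (k : ℕ), 0 < k → r < 1 / (k : ℝ) →
        (∀ y, dist y x < 1 / (k : ℝ) → dist y x ≤ k * dist (f y) (f x)) →
        ∀ᶠ t : ℝ in 𝓝[>] 0, ∃ y ∈ ball x r, f y - t • y = f x := by
      intro x k hk hrk hkb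
      have hk' : (0 : ℝ) < k := by exact_mod_cast hk
      have hc : Tendsto (fun t : ℝ => t * (2 * ‖x‖ + r)) (𝓝[>] 0) (𝓝 0) := by
        have : Continuous (fun t : ℝ => t * (2 * ‖x‖ + r)) := by fun_prop
        have h2 := this.tendsto 0
        simp only [zero_mul] at h2
        exact h2.mono_left nhdsWithin_le_nhds
      filter_upwards [hc.eventually (gt_mem_nhds (show 0 < r / k by positivity)),
        self_mem_nhdsWithin, Ioo_mem_nhdsGT hε] with t h1 h2 h3
      have h2 : (0 : ℝ) < t := h2
      refine min_lemma hr (fun y _ => hd t y) (fun y _ => (hb y t ⟨h3.1.le, h3.2⟩).2) ?_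
      intro y hy
      have hyd : dist y x = r := hy
      have h4 := hkb y (by rw [hyd]; exact hrk)
      rw [hyd, ← div_le_iff₀' hk', dist_eq_norm] at h4
      have h5 : f x - t • x - f x = -(t • x) := by abel
      have h6 : ‖f y - f x‖ ≤ ‖f y - t • y - f x‖ + t * ‖y‖ := by
        have : f y - f x = (f y - t • y - f x) + t • y := by abel
        calc ‖f y - f x‖ = ‖(f y - t • y - f x) + t • y‖ := by rw [← this]
          _ ≤ _ := (norm_add_le _ _).trans (by rw [norm_smul, Real.norm_of_nonneg h2.le])
      have h7 : ‖y‖ ≤ ‖x‖ + r := by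
        rw [← hyd, dist_eq_norm, add_comm]
        simpa using norm_add_le (y - x) x
      rw [h5, norm_neg, norm_smul, Real.norm_of_nonneg h2.le]
      nlinarith [mul_le_mul_of_nonneg_left h7 h2.le]
    obtain ⟨t, ⟨⟨y, hy, hyf⟩, ⟨y', hy', hyf'⟩⟩, ht⟩ :=
      (((key p m hm hrm hmb).and (key q n hn hrn hnb)).and (Ioo_mem_nhdsGT hε)).exists
    have heq : y = y' := slice_all f Df hdiff ε hb hd hop t ht (by simp only [hyf, hyf', hpq])
    subst heq
    have := dist_triangle_left p q y
    rw [mem_ball] at hy hy'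
    linarith
  exact ⟨(IsOpenEmbedding.of_continuous_injective_isOpenMap hfc hinj hop0).isEmbedding, hinj⟩
end
end
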